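/- If X is an indecomposable continuum in a closed surface S, then there exists a sequence (Uₙ) of complementary domains of X satisfying the double-pass condition. (This is the forward direction of the characterization theorem and does not require X to be shielded.) -/

import Mathlib

open Set Metric Filter Topology

/-- A space is locally homeomorphic to ℝ²: every point has an open
neighborhood homeomorphic to the Euclidean plane. -/
def LocallyEuclidean2 (S : Type*) [TopologicalSpace S] : Prop :=
  ∀ x : S, ∃ U : Set S, IsOpen U ∧ x ∈ U ∧
    Nonempty (U ≃ₜ EuclideanSpace ℝ (Fin 2))

section Defs

variable {S : Type*} [TopologicalSpace S]

/-- A continuum: a nonempty compact connected subset. -/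
def IsContinuum (X : Set S) : Prop := IsCompact X ∧ IsConnected X

/-- A complementary domain of `X`: a connected component of the complement of `X`. -/
def IsComplementaryDomain (X U : Set S) : Prop :=
  ∃ x, x ∉ X ∧ U = connectedComponentIn Xᶜ x

/-- A proper subcontinuum of `X`. -/
def IsProperSubcontinuum (X A : Set S) : Prop :=
  A.Nonempty ∧ IsClosed A ∧ IsConnected A ∧ A ⊆ X ∧ A ≠ X

/-- `X` is decomposable: the union of two proper subcontinua. -/
def IsDecomposable (X : Set S) : Prop :=
  ∃ A B, IsProperSubcontinuum X A ∧ IsProperSubcontinuum X B ∧ A ∪ B = X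

/-- `X` is the essential union of three proper subcontinua. -/
def IsEssentialUnionOfThree (X : Set S) : Prop :=
  ∃ X₁ X₂ X₃, IsProperSubcontinuum X X₁ ∧ IsProperSubcontinuum X X₂ ∧
    IsProperSubcontinuum X X₃ ∧ X₁ ∪ X₂ ∪ X₃ = X ∧
    ¬ X₁ ⊆ X₂ ∪ X₃ ∧ ¬ X₂ ⊆ X₁ ∪ X₃ ∧ ¬ X₃ ⊆ X₁ ∪ X₂

/-- `X` is 2-indecomposable: decomposable but not the essential union of
three proper subcontinua. -/
def Is2Indecomposable (X : Set S) : Prop :=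
  IsDecomposable X ∧ ¬ IsEssentialUnionOfThree X

/-- `X` is shielded: no complementary domain has frontier equal to `X`. -/
def IsShielded (X : Set S) : Prop :=
  ∀ U, IsComplementaryDomain X U → frontier U ≠ X

/-- A generalized crosscut of `U`. -/
def IsGenCrosscut (U A : Set S) : Prop :=
  A ⊆ U ∧ Nonempty (A ≃ₜ Set.Ioo (0:ℝ) 1) ∧ closure A \ A ⊆ frontier U

/-- `T` is a shadow of the (generalized) crosscut `A` of `U`. -/
def IsShadowOf (U A T : Set S) : Prop :=
  ∃ x ∈ U \ A, T = closure (connectedComponentIn (U \ A) x) ∩ frontier U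

/-- An arc with endpoints `a` and `b`. -/
def IsArcFrom (A : Set S) (a b : S) : Prop :=
  ∃ f : Set.Icc (0:ℝ) 1 → S, Continuous f ∧ Function.Injective f ∧
    Set.range f = A ∧ f ⟨0, by norm_num⟩ = a ∧ f ⟨1, by norm_num⟩ = b

/-- A crosscut of `U`: a copy of `(0,1)` in `U` whose closure is an arc
meeting the frontier of `U` exactly at the endpoints of the arc. -/
def IsCrosscut (U K : Set S) : Prop :=
  K ⊆ U ∧ Nonempty (K ≃ₜ Set.Ioo (0:ℝ) 1) ∧
    ∃ a b, IsArcFrom (closure K) a b ∧ closure K ∩ frontier U = {a, b}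

/-- A closed disk: a set homeomorphic to the closed unit disk in ℝ². -/
def IsClosedDisk (D : Set S) : Prop :=
  Nonempty (D ≃ₜ Metric.closedBall (0 : EuclideanSpace ℝ (Fin 2)) 1)

/-- A cat's cradle between `d₁` and `d₃`: a family of arcs from `d₁` to `d₃`
whose interiors are pairwise disjoint. -/
def IsCatsCradle {ι : Type*} (d₁ d₃ : S) (A : ι → Set S) : Prop :=
  (∀ i, IsArcFrom (A i) d₁ d₃) ∧
    Pairwise fun i j => (A i \ {d₁, d₃}) ∩ (A j \ {d₁, d₃}) = ∅

/-- A cat's cradle between `d₁` and `d₃` through `D₂`. -/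
def IsCatsCradleThrough {ι : Type*} (d₁ d₃ : S) (D₂ : Set S) (A : ι → Set S) : Prop :=
  IsCatsCradle d₁ d₃ A ∧ D₂ ∩ {d₁, d₃} = ∅ ∧ ∀ i, (A i ∩ D₂).Nonempty

/-- A chord of the closed disk `D`: an arc in `D` meeting the frontier of `D`
exactly at its two endpoints. -/
def IsChord (D A : Set S) : Prop :=
  ∃ a b, IsArcFrom A a b ∧ A ⊆ D ∧ A ∩ frontier D = {a, b}

/-- A sequence of pairwise disjoint chords of `D` is linearly ordered if each
middle chord separates the earlier ones from the later ones in `D`. -/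
def LinearlyOrderedChords (D : Set S) (A : ℕ → Set S) : Prop :=
  (Pairwise fun i j => Disjoint (A i) (A j)) ∧
    ∀ i j k, i < j → j < k → ∀ x ∈ A i, ∀ y ∈ A k,
      connectedComponentIn (D \ A j) x ≠ connectedComponentIn (D \ A j) y

end Defs

section MetricDefs

variable {S : Type*} [MetricSpace S]

/-- Convergence of a sequence of sets to `X` in the Hausdorff metric. -/
def HausdorffConvergesTo (A : ℕ → Set S) (X : Set S) : Prop :=
  Tendsto (fun n => hausdorffDist (A n) X) atTop (𝓝 0)

/-- The double-pass condition for a sequence of domains. -/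
def DoublePassCondition (X : Set S) (U : ℕ → Set S) : Prop :=
  ∀ K : ℕ → Set S, (∀ n, IsGenCrosscut (U n) (K n)) →
    ∃ Sh : ℕ → Set S, (∀ n, IsShadowOf (U n) (K n) (Sh n)) ∧ HausdorffConvergesTo Sh X

/-- The double-pass condition with (genuine) crosscuts. -/
def DoublePassConditionCrosscuts (X : Set S) (U : ℕ → Set S) : Prop :=
  ∀ K : ℕ → Set S, (∀ n, IsCrosscut (U n) (K n)) →
    ∃ Sh : ℕ → Set S, (∀ n, IsShadowOf (U n) (K n) (Sh n)) ∧ HausdorffConvergesTo Sh X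

end MetricDefs



/-- The exponential with period one. -/
noncomputable def ex (z : ℂ) : ℂ := Complex.exp (2 * Real.pi * Complex.I * z)

theorem ex_add (a b : ℂ) : ex (a + b) = ex a * ex b := by
  simp [ex, mul_add, Complex.exp_add]

theorem ex_sub (a b : ℂ) : ex (a - b) = ex a / ex b := by
  simp [ex, mul_sub, Complex.exp_sub]

theorem ex_ne_zero (a : ℂ) : ex a ≠ 0 := Complex.exp_ne_zero _

theorem ex_zero : ex 0 = 1 := by simp [ex]

theorem ex_continuous : Continuous ex := by unfold ex; fun_prop

theorem two_pi_I_ne : (2 * Real.pi * Complex.I : ℂ) ≠ 0 := Complex.two_pi_I_ne_zero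

theorem ex_eq_one_iff (z : ℂ) : ex z = 1 ↔ ∃ n : ℤ, z = n := by
  unfold ex
  rw [Complex.exp_eq_one_iff]
  constructor
  · rintro ⟨n, hn⟩
    refine ⟨n, ?_⟩
    rw [mul_comm (n : ℂ)] at hn
    exact mul_left_cancel₀ two_pi_I_ne hn
  · rintro ⟨n, rfl⟩
    exact ⟨n, by ring⟩

theorem ex_int (n : ℤ) : ex n = 1 := (ex_eq_one_iff _).2 ⟨n, rfl⟩

theorem ex_one : ex 1 = 1 := by simpa using ex_int 1

theorem ex_int_mul (n : ℤ) (z : ℂ) : ex (n * z) = ex z ^ n := by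
  unfold ex
  rw [← Complex.exp_int_mul]
  congr 1; ring

theorem ex_sum {ι : Type*} (s : Finset ι) (f : ι → ℂ) : ex (∑ i ∈ s, f i) = ∏ i ∈ s, ex (f i) := by
  unfold ex
  rw [← Complex.exp_sum, Finset.mul_sum]

/-- Continuous logarithms exist on simply connected spaces. -/
theorem exists_lift {A : Type*} [TopologicalSpace A] [SimplyConnectedSpace A]
    [LocallyPathConnectedSpace A] (f : A → ℂ) (hf : Continuous f) (h0 : ∀ a, f a ≠ 0) :
    ∃ F : A → ℂ, Continuous F ∧ ∀ a, ex (F a) = f a := by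
  have hne : Nonempty A := inferInstance
  obtain ⟨a₀⟩ := hne
  obtain ⟨F, ⟨-, hF⟩, -⟩ := Complex.isCoveringMapOn_exp.existsUnique_continuousMap_lifts
    (⟨f, hf⟩ : C(A, ℂ)) (a₀ := a₀) (e₀ := Complex.log (f a₀)) (Complex.exp_log (h0 a₀))
    (fun a => h0 a)
  refine ⟨fun a => F a / (2 * Real.pi * Complex.I), F.continuous.div_const _, fun a => ?_⟩
  unfold ex
  rw [mul_div_cancel₀ _ two_pi_I_ne]
  exact congrFun hF a

theorem ex_const {α : Type*} [TopologicalSpace α] {s : Set α} (hs : IsPreconnected s) {φ : α → ℂ}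
    (hφ : ContinuousOn φ s) (h1 : ∀ x ∈ s, ex (φ x) = 1) {x y : α} (hx : x ∈ s) (hy : y ∈ s) :
    φ x = φ y := by
  have hre : ContinuousOn (fun z => (φ z).re) s := Complex.continuous_re.comp_continuousOn hφ
  have key : ∀ z ∈ s, ∃ n : ℤ, φ z = n := fun z hz => (ex_eq_one_iff _).1 (h1 z hz)
  choose! n hn using key
  have hn' : ContinuousOn n s := by
    rw [Int.isClosedEmbedding_coe_real.isInducing.continuousOn_iff]
    refine hre.congr fun z hz => ?_
    simp [hn z hz]
  have := hs.constant (f := n) hn' hx hy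
  rw [hn x hx, hn y hy, this]

/-- A set on which every nonvanishing continuous function has a logarithm. -/
def HasLogs {α : Type*} [TopologicalSpace α] (J : Set α) : Prop :=
  ∀ u : α → ℂ, ContinuousOn u J → (∀ z ∈ J, u z ≠ 0) →
    ∃ L : α → ℂ, ContinuousOn L J ∧ ∀ z ∈ J, ex (L z) = u z

theorem hasLogs_arc {a b : ℝ} (hab : a ≤ b) (γ : Icc a b → ℂ) (hγ : Continuous γ)
    (hinj : Function.Injective γ) : HasLogs (range γ) := by
  intro u hu h0
  have hc : Continuous (fun t : ℝ => u (γ (projIcc a b hab t))) := by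
    have h1 : Continuous (fun t : ℝ => γ (projIcc a b hab t)) := hγ.comp continuous_projIcc
    exact hu.comp_continuous h1 (fun t => mem_range_self _)
  obtain ⟨F, hF, hF'⟩ := exists_lift _ hc (fun t => h0 _ (mem_range_self _))
  have hemb : IsEmbedding γ := (hγ.isClosedEmbedding hinj).isEmbedding
  refine ⟨Function.extend γ (fun t => F t) 0, ?_, ?_⟩
  · rw [continuousOn_iff_continuous_domRestrict]
    have : (range γ).domRestrict (Function.extend γ (fun t => F t) 0) =
        fun z => F (hemb.toHomeomorph.symm z : ℝ) := by
      ext z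
      obtain ⟨t, rfl⟩ := hemb.toHomeomorph.surjective z
      simp [hinj.extend_apply]
    rw [this]
    exact hF.comp (continuous_subtype_val.comp hemb.toHomeomorph.symm.continuous)
  · rintro _ ⟨t, rfl⟩
    rw [hinj.extend_apply, hF']
    simp

/-- Closure of a component. -/
theorem closure_comp_inter {α : Type*} [TopologicalSpace α] [LocallyConnectedSpace α] {O : Set α}
    (hO : IsOpen O) (x : α) : closure (connectedComponentIn O x) ∩ O ⊆ connectedComponentIn O x := by
  rintro y ⟨hy, hyO⟩
  have hop : IsOpen (connectedComponentIn O y) := hO.connectedComponentIn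
  obtain ⟨z, hz1, hz2⟩ := mem_closure_iff.1 hy _ hop (mem_connectedComponentIn hyO)
  rw [connectedComponentIn_eq hz2, ← connectedComponentIn_eq hz1]
  exact mem_connectedComponentIn hyO

theorem frontier_comp_subset {α : Type*} [TopologicalSpace α] [LocallyConnectedSpace α] {O : Set α}
    (hO : IsOpen O) (x : α) : frontier (connectedComponentIn O x) ⊆ Oᶜ := by
  intro y hy hyO
  have hop : IsOpen (connectedComponentIn O x) := hO.connectedComponentIn
  rw [hop.frontier_eq] at hy
  exact hy.2 (closure_comp_inter hO x ⟨hy.1, hyO⟩)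

theorem continuous_of_closed_cover {α β : Type*} [TopologicalSpace α] [TopologicalSpace β]
    {A B : Set α} (hA : IsClosed A) (hB : IsClosed B) (hAB : A ∪ B = univ) {f : α → β}
    (h1 : ContinuousOn f A) (h2 : ContinuousOn f B) : Continuous f := by
  rw [← continuousOn_univ, ← hAB]
  exact h1.union_of_isClosed h2 hA hB

theorem eilenberg {Y : Set ℂ} (hY : IsClosed Y) {q : ℂ} {R : ℝ}
    (hR : connectedComponentIn Yᶜ q ⊆ closedBall q R) (hq : q ∉ Y) (P : ℂ → ℂ)
    (hP : ContinuousOn P (closure (connectedComponentIn Yᶜ q)))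
    (hP0 : ∀ z ∈ closure (connectedComponentIn Yᶜ q), P z ≠ 0) (a : ℤ) (L : ℂ → ℂ)
    (hL : ContinuousOn L Y) (hLY : ∀ z ∈ Y, ex (L z) = (z - q) ^ a * P z) : a = 0 := by
  classical
  set Q := connectedComponentIn Yᶜ q with hQ
  have hQo : IsOpen Q := hY.isOpen_compl.connectedComponentIn
  have hqQ : q ∈ Q := mem_connectedComponentIn hq
  have hfr : frontier Q ⊆ Y := by
    have := frontier_comp_subset hY.isOpen_compl q
    rwa [compl_compl] at this
  obtain ⟨L', hL'⟩ := ContinuousMap.exists_restrict_eq hY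
    (⟨Y.domRestrict L, continuousOn_iff_continuous_domRestrict.1 hL⟩ : C(Y, ℂ))
  have hLL : ∀ z ∈ Y, L' z = L z := fun z hz => by
    have := congrArg (fun f : C(Y, ℂ) => f ⟨z, hz⟩) hL'
    exact this
  let G : ℂ → ℂ := fun z => if z ∈ Q then P z else ex (L' z) / (z - q) ^ a
  have hG1 : ∀ z ∈ closure Q, G z = P z := by
    intro z hz
    by_cases h : z ∈ Q
    · simp [G, h]
    · have hzf : z ∈ frontier Q := by rw [hQo.frontier_eq]; exact ⟨hz, h⟩
      have hzY := hfr hzf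
      have hne : z - q ≠ 0 := sub_ne_zero.2 (by rintro rfl; exact h hqQ)
      simp only [G, h, if_false]
      rw [hLL z hzY, hLY z hzY, mul_div_cancel_left₀ _ (zpow_ne_zero _ hne)]
  have hG2 : ∀ z ∈ Qᶜ, G z = ex (L' z) / (z - q) ^ a := by
    intro z hz
    simp only [G, if_neg hz]
  have hGc : Continuous G := by
    refine continuous_of_closed_cover isClosed_closure hQo.isClosed_compl ?_
      (hP.congr hG1) (ContinuousOn.congr ?_ hG2)
    · rw [eq_univ_iff_forall]
      intro z
      by_cases h : z ∈ Q
      · exact Or.inl (subset_closure h)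
      · exact Or.inr h
    · have h1 : Continuous fun z => ex (L' z) := ex_continuous.comp L'.continuous
      refine h1.continuousOn.div ?_ ?_
      · refine ContinuousOn.zpow₀ (by fun_prop) a ?_
        intro z hz
        left
        exact sub_ne_zero.2 (by rintro rfl; exact hz hqQ)
      · intro z hz
        exact zpow_ne_zero _ (sub_ne_zero.2 (by rintro rfl; exact hz hqQ))
  have hG0 : ∀ z, G z ≠ 0 := by
    intro z
    by_cases h : z ∈ Q
    · rw [hG1 z (subset_closure h)]; exact hP0 z (subset_closure h)
    · rw [hG2 z h]
      exact div_ne_zero (ex_ne_zero _)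
        (zpow_ne_zero _ (sub_ne_zero.2 (by rintro rfl; exact h hqQ)))
  obtain ⟨M, hM, hMG⟩ := exists_lift G hGc hG0
  set R' : ℝ := max R 0 + 1 with hR'
  have hR'0 : (0:ℝ) < R' := by positivity
  have hRR : R < R' := lt_of_le_of_lt (le_max_left R 0) (lt_add_one _)
  let c : ℝ → ℂ := fun s => q + R' * ex s
  have hcc : Continuous c := by
    have := ex_continuous
    fun_prop
  have hnorm : ∀ s : ℝ, ‖ex s‖ = 1 := by
    intro s
    unfold ex
    rw [show (2 * Real.pi * Complex.I * s : ℂ) = ((2 * Real.pi * s : ℝ) : ℂ) * Complex.I by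
      push_cast; ring]
    exact Complex.norm_exp_ofReal_mul_I _
  have hcQ : ∀ s, c s ∈ Qᶜ := by
    intro s hs
    have := hR hs
    rw [mem_closedBall, dist_eq_norm] at this
    simp only [c, add_sub_cancel_left, norm_mul, hnorm, mul_one, Complex.norm_real,
      Real.norm_of_nonneg hR'0.le] at this
    linarith
  let N : ℝ → ℂ := fun s => L' (c s) - M (c s)
  have hN : Continuous N := (L'.continuous.comp hcc).sub (hM.comp hcc)
  have hexN : ∀ s, ex (N s) = (R' : ℂ) ^ a * ex s ^ a := by
    intro s
    have h1 := hMG (c s)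
    rw [hG2 _ (hcQ s)] at h1
    simp only [N]
    rw [ex_sub, h1, div_div_cancel₀ (ex_ne_zero _)]
    simp only [c, add_sub_cancel_left, mul_zpow]
  let T : ℝ → ℂ := fun s => N s - a * s - N 0
  have hT : Continuous T := by fun_prop
  have hT1 : ∀ s ∈ (univ : Set ℝ), ex (T s) = 1 := by
    intro s _
    simp only [T]
    rw [ex_sub, ex_sub, ex_int_mul, hexN, hexN]
    have e0 : ex ((0:ℝ):ℂ) = 1 := by simpa using ex_zero
    rw [e0, one_zpow, mul_one, mul_div_cancel_right₀ _ (zpow_ne_zero _ (ex_ne_zero _)), div_self]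
    exact zpow_ne_zero _ (by exact_mod_cast hR'0.ne')
  have hfin := ex_const isPreconnected_univ hT.continuousOn hT1 (mem_univ (0:ℝ)) (mem_univ (1:ℝ))
  have hc01 : c 1 = c 0 := by
    simp only [c]
    have e0 : ex ((0:ℝ):ℂ) = 1 := by simpa using ex_zero
    have e1 : ex ((1:ℝ):ℂ) = 1 := by simpa using ex_one
    rw [e0, e1]
  have hN01 : N 1 = N 0 := by simp only [N, hc01]
  simp only [T, hN01] at hfin
  have : (a : ℂ) = 0 := by
    have h2 := hfin
    push_cast at h2
    linear_combination h2
  exact_mod_cast this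


theorem log_ratio {F : Set ℂ} {x : ℂ} {ρ : ℝ} (hF : Disjoint (ball x ρ) F) {q q' : ℂ}
    (hq : q ∈ ball x ρ) (hq' : q' ∈ ball x ρ) :
    ∃ L : ℂ → ℂ, ContinuousOn L F ∧ ∀ z ∈ F, ex (L z) = (z - q) / (z - q') := by
  have hne : ∀ z ∈ F, z - q' ≠ 0 := fun z hz h0 => by
    rw [sub_eq_zero] at h0
    subst h0
    exact disjoint_left.1 hF hq' hz
  have hne' : ∀ z ∈ F, z - q ≠ 0 := fun z hz h0 => by
    rw [sub_eq_zero] at h0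
    subst h0
    exact disjoint_left.1 hF hq hz
  have hslit : ∀ z ∈ F, (z - q) / (z - q') ∈ Complex.slitPlane := by
    intro z hz
    by_contra hns
    rw [Complex.mem_slitPlane_iff_not_le_zero, not_not, Complex.le_def] at hns
    obtain ⟨h1, h2⟩ := hns
    set w := (z - q) / (z - q') with hw
    have hwt : w = ((w.re : ℝ) : ℂ) := Complex.ext (by simp) (by simpa using h2)
    have h1' : w.re ≤ 0 := by simpa using h1
    set t : ℝ := w.re with ht
    have hzq : z - q = t * (z - q') := by
      rw [← hwt, hw, div_mul_cancel₀ _ (hne z hz)]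
    apply disjoint_left.1 hF _ hz
    have hpos : (0:ℝ) < 1 - t := by linarith
    have hposC : (1 - t : ℂ) ≠ 0 := by exact_mod_cast hpos.ne'
    have : z = ((1 / (1 - t) : ℝ)) • q + ((-t / (1 - t) : ℝ)) • q' := by
      simp only [Complex.real_smul]
      push_cast
      field_simp
      linear_combination hzq
    rw [this]
    refine (convex_ball x ρ) hq hq' (by positivity) (div_nonneg (by linarith) hpos.le) ?_
    field_simp
    ring
  refine ⟨fun z => Complex.log ((z - q) / (z - q')) / (2 * Real.pi * Complex.I), ?_, ?_⟩
  · refine ContinuousOn.div_const (ContinuousOn.clog ?_ hslit) _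
    exact ContinuousOn.div (by fun_prop) (by fun_prop) hne
  · intro z hz
    unfold ex
    rw [mul_div_cancel₀ _ two_pi_I_ne, Complex.exp_log]
    exact div_ne_zero (hne' z hz) (hne z hz)

theorem not_mem_closure_comp {α : Type*} [TopologicalSpace α] [LocallyConnectedSpace α] {O : Set α}
    (hO : IsOpen O) {x y : α} (hy : y ∈ O) (h : y ∉ connectedComponentIn O x) :
    y ∉ closure (connectedComponentIn O x) := fun hc => h (closure_comp_inter hO x ⟨hc, hy⟩)

theorem eil3 {Y : Set ℂ} (hY : IsClosed Y) {q1 q2 q3 : ℂ} {x : ℂ} {R : ℝ}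
    (hR : Yᶜ ⊆ ball x R) (h1 : q1 ∉ Y) (h2 : q2 ∉ Y) (h3 : q3 ∉ Y)
    (h12 : q2 ∉ connectedComponentIn Yᶜ q1) (h13 : q3 ∉ connectedComponentIn Yᶜ q1)
    (m n : ℤ) (L : ℂ → ℂ) (hL : ContinuousOn L Y)
    (hLY : ∀ z ∈ Y, ex (L z) = ((z - q1) / (z - q2)) ^ m * ((z - q2) / (z - q3)) ^ n) : m = 0 := by
  have n2 : ∀ z ∈ closure (connectedComponentIn Yᶜ q1), z - q2 ≠ 0 := fun z hz h0 => by
    rw [sub_eq_zero] at h0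
    subst h0
    exact not_mem_closure_comp hY.isOpen_compl h2 h12 hz
  have n3 : ∀ z ∈ closure (connectedComponentIn Yᶜ q1), z - q3 ≠ 0 := fun z hz h0 => by
    rw [sub_eq_zero] at h0
    subst h0
    exact not_mem_closure_comp hY.isOpen_compl h3 h13 hz
  refine eilenberg (R := R + R) hY ?_ h1 (fun z => ((z - q2) ^ m)⁻¹ * ((z - q2) / (z - q3)) ^ n)
    ?_ ?_ m L hL ?_
  · refine (connectedComponentIn_subset _ _).trans fun z hz => ?_
    have a1 := mem_ball.1 (hR hz)
    have a2 := mem_ball.1 (hR (show q1 ∈ Yᶜ from h1))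
    rw [mem_closedBall]
    have := dist_triangle_right z q1 x
    linarith
  · refine ContinuousOn.mul (ContinuousOn.inv₀ ?_ ?_) ?_
    · exact ContinuousOn.zpow₀ (by fun_prop) _ fun z hz => Or.inl (n2 z hz)
    · exact fun z hz => zpow_ne_zero _ (n2 z hz)
    · refine ContinuousOn.zpow₀ (ContinuousOn.div (by fun_prop) (by fun_prop) n3) _ fun z hz => ?_
      exact Or.inl (div_ne_zero (n2 z hz) (n3 z hz))
  · intro z hz
    exact mul_ne_zero (inv_ne_zero (zpow_ne_zero _ (n2 z hz)))
      (zpow_ne_zero _ (div_ne_zero (n2 z hz) (n3 z hz)))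
  · intro z hz
    rw [hLY z hz, div_zpow, div_eq_mul_inv, mul_assoc]

theorem glue_on {α β : Type*} [TopologicalSpace α] [TopologicalSpace β] {F J : Set α}
    (hF : IsClosed F) (hJ : IsClosed J) {L M : α → β} (hL : ContinuousOn L F)
    (hM : ContinuousOn M J) (h : ∀ z ∈ F ∩ J, L z = M z) :
    ∃ G : α → β, ContinuousOn G (F ∪ J) ∧ (∀ z ∈ F, G z = L z) ∧ ∀ z ∈ J, G z = M z := by
  classical
  have h1 : ∀ z ∈ F, (fun z => if z ∈ F then L z else M z) z = L z := fun z hz => by simp [hz]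
  have h2 : ∀ z ∈ J, (fun z => if z ∈ F then L z else M z) z = M z := fun z hz => by
    by_cases hz' : z ∈ F
    · simp [hz', h z ⟨hz', hz⟩]
    · simp [hz']
  exact ⟨_, (hL.congr h1).union_of_isClosed (hM.congr h2) hF hJ, h1, h2⟩

theorem pair_logs {F J : Set ℂ} {x : ℂ} {ρ : ℝ} (hF : Disjoint (ball x ρ) F) (hJ : HasLogs J)
    (c d : ℂ) {q q' : ℂ} (hq : q ∈ ball x ρ) (hq' : q' ∈ ball x ρ) (hqJ : q ∉ J) (hqJ' : q' ∉ J) :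
    ∃ (L M : ℂ → ℂ) (k : ℤ), ContinuousOn L F ∧ ContinuousOn M J ∧
      (∀ z ∈ F, ex (L z) = (z - q) / (z - q')) ∧ (∀ z ∈ J, ex (M z) = (z - q) / (z - q')) ∧
      (c ∈ F ∩ J → L c = M c) ∧ (d ∈ F ∩ J → L d - M d = k) := by
  classical
  obtain ⟨L, hL, hL'⟩ := log_ratio hF hq hq'
  have n1 : ∀ z ∈ J, z - q' ≠ 0 := fun z hz h0 => by
    rw [sub_eq_zero] at h0; subst h0; exact hqJ' hz
  have n2 : ∀ z ∈ J, z - q ≠ 0 := fun z hz h0 => by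
    rw [sub_eq_zero] at h0; subst h0; exact hqJ hz
  obtain ⟨M, hM, hM'⟩ := hJ (fun z => (z - q) / (z - q'))
    (ContinuousOn.div (by fun_prop) (by fun_prop) n1) (fun z hz => div_ne_zero (n2 z hz) (n1 z hz))
  have key : ∀ z ∈ F ∩ J, ∃ k : ℤ, L z - M z = k := fun z hz => by
    rw [← ex_eq_one_iff, ex_sub, hL' z hz.1, hM' z hz.2, div_self]
    exact div_ne_zero (n2 z hz.2) (n1 z hz.2)
  have hk : ∃ k : ℤ, c ∈ F ∩ J → L c - M c = k := by
    by_cases hc : c ∈ F ∩ J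
    · obtain ⟨k, hk⟩ := key c hc; exact ⟨k, fun _ => hk⟩
    · exact ⟨0, fun h => absurd h hc⟩
  obtain ⟨k, hk⟩ := hk
  have hl : ∃ l : ℤ, d ∈ F ∩ J → L d - M d = l := by
    by_cases hc : d ∈ F ∩ J
    · obtain ⟨k, hk⟩ := key d hc; exact ⟨k, fun _ => hk⟩
    · exact ⟨0, fun h => absurd h hc⟩
  obtain ⟨l, hl⟩ := hl
  refine ⟨L, fun z => M z + k, l - k, hL, hM.add continuousOn_const, hL', ?_, ?_, ?_⟩
  · intro z hz
    rw [ex_add, ex_int, mul_one, hM' z hz]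
  · intro h
    linear_combination hk h
  · intro h
    push_cast
    linear_combination hl h

theorem PL1_core {F J : Set ℂ} (hFc : IsClosed F) (hJc : IsClosed J) {x : ℂ} {ρ R : ℝ}
    (hR : (F ∪ J)ᶜ ⊆ ball x R)
    (hF : Disjoint (ball x ρ) F) (hJ : HasLogs J) (c : ℂ) (hFJ : F ∩ J ⊆ {c})
    {q q' : ℂ} (hq : q ∈ ball x ρ) (hq' : q' ∈ ball x ρ) (hqJ : q ∉ J) (hqJ' : q' ∉ J) :
    q' ∈ connectedComponentIn (F ∪ J)ᶜ q := by
  by_contra hcon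
  obtain ⟨L, M, k, hL, hM, hL', hM', hc, -⟩ := pair_logs hF hJ c c hq hq' hqJ hqJ'
  obtain ⟨G, hG, hGF, hGJ⟩ := glue_on hFc hJc hL hM (fun z hz => by
    have := hFJ hz
    simp only [mem_singleton_iff] at this
    subst this
    exact hc hz)
  have a1 : q ∉ F ∪ J := fun h => h.elim (disjoint_left.1 hF hq) hqJ
  have a2 : q' ∉ F ∪ J := fun h => h.elim (disjoint_left.1 hF hq') hqJ'
  have := eil3 (hFc.union hJc) hR a1 a2 a2 hcon hcon 1 0 G hG (by
    rintro z (hz | hz)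
    · rw [hGF z hz, hL' z hz]; simp
    · rw [hGJ z hz, hM' z hz]; simp)
  exact one_ne_zero this

theorem PL2_core {F J : Set ℂ} (hFc : IsClosed F) (hJc : IsClosed J) {x : ℂ} {ρ R : ℝ}
    (hR : (F ∪ J)ᶜ ⊆ ball x R)
    (hF : Disjoint (ball x ρ) F) (hJ : HasLogs J) (c d : ℂ) (hFJ : F ∩ J ⊆ {c, d})
    {q1 q2 q3 : ℂ} (hq1 : q1 ∈ ball x ρ) (hq2 : q2 ∈ ball x ρ) (hq3 : q3 ∈ ball x ρ)
    (hJ1 : q1 ∉ J) (hJ2 : q2 ∉ J) (hJ3 : q3 ∉ J) :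
    q2 ∈ connectedComponentIn (F ∪ J)ᶜ q1 ∨ q3 ∈ connectedComponentIn (F ∪ J)ᶜ q1 ∨
    q3 ∈ connectedComponentIn (F ∪ J)ᶜ q2 := by
  by_contra hcon
  push Not at hcon
  obtain ⟨h12, h13, h23⟩ := hcon
  obtain ⟨L, M, k, hL, hM, hL', hM', hc, hd⟩ := pair_logs hF hJ c d hq1 hq2 hJ1 hJ2
  obtain ⟨K, N, l, hK, hN, hK', hN', hc', hd'⟩ := pair_logs hF hJ c d hq2 hq3 hJ2 hJ3
  have a1 : q1 ∉ F ∪ J := fun h => h.elim (disjoint_left.1 hF hq1) hJ1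
  have a2 : q2 ∉ F ∪ J := fun h => h.elim (disjoint_left.1 hF hq2) hJ2
  have a3 : q3 ∉ F ∪ J := fun h => h.elim (disjoint_left.1 hF hq3) hJ3
  obtain ⟨G, hG, hGF, hGJ⟩ := glue_on hFc hJc (L := fun z => l * L z + ((-k : ℤ) : ℂ) * K z)
    (M := fun z => l * M z + ((-k : ℤ) : ℂ) * N z)
    ((continuousOn_const.mul hL).add (continuousOn_const.mul hK))
    ((continuousOn_const.mul hM).add (continuousOn_const.mul hN)) (fun z hz => by
      rcases hFJ hz with rfl | h
      · simp only [hc hz, hc' hz]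
      · rw [mem_singleton_iff] at h
        subst h
        push_cast
        linear_combination (l : ℂ) * hd hz - (k : ℂ) * hd' hz)
  have hl := eil3 (hFc.union hJc) hR a1 a2 a3 h12 h13 l (-k) G hG (by
    rintro z (hz | hz)
    · rw [hGF z hz, ex_add, ex_int_mul, ex_int_mul, hL' z hz, hK' z hz]
    · rw [hGJ z hz, ex_add, ex_int_mul, ex_int_mul, hM' z hz, hN' z hz])
  subst hl
  obtain ⟨G, hG, hGF, hGJ⟩ := glue_on hFc hJc hK hN (fun z hz => by
      rcases hFJ hz with rfl | h
      · exact hc' hz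
      · rw [mem_singleton_iff] at h
        subst h
        have := hd' hz
        push_cast at this
        linear_combination this)
  have := eil3 (hFc.union hJc) hR a2 a3 a3 h23 h23 1 0 G hG (by
    rintro z (hz | hz)
    · rw [hGF z hz, hK' z hz]; simp
    · rw [hGJ z hz, hN' z hz]; simp)
  exact one_ne_zero this

/-- Enlarging a closed set by the exterior of a large ball. -/
theorem enlarge {F J : Set ℂ} (hFc : IsClosed F) (hJc : IsCompact J) {x : ℂ} {ρ : ℝ}
    (hF : Disjoint (ball x ρ) F) :
    ∃ (F' : Set ℂ) (R : ℝ), IsClosed F' ∧ F ⊆ F' ∧ (F' ∪ J)ᶜ ⊆ ball x R ∧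
      Disjoint (ball x ρ) F' ∧ F' ∩ J = F ∩ J := by
  obtain ⟨r, hr⟩ := hJc.isBounded.subset_ball x
  refine ⟨F ∪ (ball x (max r ρ))ᶜ, max r ρ, hFc.union isOpen_ball.isClosed_compl,
    subset_union_left, ?_, ?_, ?_⟩
  · intro z hz
    by_contra h
    exact hz (Or.inl (Or.inr h))
  · rw [disjoint_union_right]
    refine ⟨hF, ?_⟩
    rw [disjoint_compl_right_iff_subset]
    exact ball_subset_ball (le_max_right _ _)
  · ext z
    constructor
    · rintro ⟨h | h, hz⟩
      · exact ⟨h, hz⟩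
      · exact absurd (ball_subset_ball (le_max_left _ _) (hr hz)) h
    · rintro ⟨h, hz⟩
      exact ⟨Or.inl h, hz⟩

theorem PL1 {F J : Set ℂ} (hFc : IsClosed F) (hJc : IsCompact J) {x : ℂ} {ρ : ℝ}
    (hF : Disjoint (ball x ρ) F) (hJ : HasLogs J) (c : ℂ) (hFJ : F ∩ J ⊆ {c})
    {q q' : ℂ} (hq : q ∈ ball x ρ) (hq' : q' ∈ ball x ρ) (hqJ : q ∉ J) (hqJ' : q' ∉ J) :
    q' ∈ connectedComponentIn (F ∪ J)ᶜ q := by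
  obtain ⟨F', R, h1, h2, h3, h4, h5⟩ := enlarge hFc hJc hF
  refine connectedComponentIn_mono _ ?_
    (PL1_core h1 hJc.isClosed h3 h4 hJ c (h5.trans_subset hFJ) hq hq' hqJ hqJ')
  exact compl_subset_compl.2 (union_subset_union_left _ h2)

theorem PL2 {F J : Set ℂ} (hFc : IsClosed F) (hJc : IsCompact J) {x : ℂ} {ρ : ℝ}
    (hF : Disjoint (ball x ρ) F) (hJ : HasLogs J) (c d : ℂ) (hFJ : F ∩ J ⊆ {c, d})
    {q1 q2 q3 : ℂ} (hq1 : q1 ∈ ball x ρ) (hq2 : q2 ∈ ball x ρ) (hq3 : q3 ∈ ball x ρ)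
    (hJ1 : q1 ∉ J) (hJ2 : q2 ∉ J) (hJ3 : q3 ∉ J) :
    q2 ∈ connectedComponentIn (F ∪ J)ᶜ q1 ∨ q3 ∈ connectedComponentIn (F ∪ J)ᶜ q1 ∨
    q3 ∈ connectedComponentIn (F ∪ J)ᶜ q2 := by
  obtain ⟨F', R, h1, h2, h3, h4, h5⟩ := enlarge hFc hJc hF
  have hm : (F' ∪ J)ᶜ ⊆ (F ∪ J)ᶜ := compl_subset_compl.2 (union_subset_union_left _ h2)
  rcases PL2_core h1 hJc.isClosed h3 h4 hJ c d (h5.trans_subset hFJ) hq1 hq2 hq3 hJ1 hJ2 hJ3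
    with h | h | h
  · exact Or.inl (connectedComponentIn_mono _ hm h)
  · exact Or.inr (Or.inl (connectedComponentIn_mono _ hm h))
  · exact Or.inr (Or.inr (connectedComponentIn_mono _ hm h))


theorem hasLogs_range {A α : Type*} [TopologicalSpace A] [SimplyConnectedSpace A]
    [LocallyPathConnectedSpace A] [TopologicalSpace α] {e : A → α} (hemb : IsEmbedding e) :
    HasLogs (range e) := by
  intro u hu h0
  have hc : Continuous (fun t : A => u (e t)) :=
    hu.comp_continuous hemb.continuous (fun t => mem_range_self _)
  obtain ⟨F, hF, hF'⟩ := exists_lift _ hc (fun t => h0 _ (mem_range_self _))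
  have hinj := hemb.injective
  refine ⟨Function.extend e F 0, ?_, ?_⟩
  · rw [continuousOn_iff_continuous_domRestrict]
    have : (range e).domRestrict (Function.extend e F 0) =
        fun z => F (hemb.toHomeomorph.symm z) := by
      ext z
      obtain ⟨t, rfl⟩ := hemb.toHomeomorph.surjective z
      simp [hinj.extend_apply]
    rw [this]
    exact hF.comp hemb.toHomeomorph.symm.continuous
  · rintro _ ⟨t, rfl⟩
    rw [hinj.extend_apply, hF']

theorem chartC {S : Type*} [TopologicalSpace S] (hS : LocallyEuclidean2 S) (x : S) :
    ∃ e : ℂ → S, IsOpenEmbedding e ∧ x ∈ range e := by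
  obtain ⟨U, hU, hx, ⟨h⟩⟩ := hS x
  let g : ℂ ≃ₜ U := Complex.orthonormalBasisOneI.repr.toHomeomorph.trans h.symm
  refine ⟨fun z => g z, hU.isOpenEmbedding_subtypeVal.comp g.isOpenEmbedding, ?_⟩
  exact ⟨g.symm ⟨x, hx⟩, by simp⟩

theorem local_disc {S : Type*} [TopologicalSpace S] (hS : LocallyEuclidean2 S) {G : Set S}
    (hG : IsOpen G) {x : S} (hx : x ∈ G) :
    ∃ D, IsOpen D ∧ x ∈ D ∧ D ⊆ G ∧ HasLogs D ∧ IsConnected D := by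
  obtain ⟨e, he, z, rfl⟩ := chartC hS x
  obtain ⟨r, hr, hb⟩ := Metric.isOpen_iff.1 (hG.preimage he.continuous) z hx
  have hne : (ball z r).Nonempty := ⟨z, mem_ball_self hr⟩
  have : ContractibleSpace (ball z r) := (convex_ball z r).contractibleSpace hne
  have : LocallyPathConnectedSpace (ball z r) := isOpen_ball.locallyPathConnectedSpace
  refine ⟨e '' ball z r, he.isOpenMap _ isOpen_ball, mem_image_of_mem _ (mem_ball_self hr),
    image_subset_iff.2 hb, ?_, ?_⟩
  · have hL := hasLogs_range (he.isEmbedding.comp (IsEmbedding.subtypeVal (p := (· ∈ ball z r))))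
    rw [range_comp, Subtype.range_coe_subtype] at hL
    exact hL
  · exact ⟨hne.image _, (convex_ball z r).isPreconnected.image _ he.continuous.continuousOn⟩

theorem locConn {S : Type*} [TopologicalSpace S] (hS : LocallyEuclidean2 S) :
    LocallyConnectedSpace S := by
  rw [locallyConnectedSpace_iff_subsets_isOpen_isConnected]
  intro x U hU
  obtain ⟨V, hVU, hV, hx⟩ := mem_nhds_iff.1 hU
  obtain ⟨D, h1, h2, h3, -, h4⟩ := local_disc hS hV hx
  exact ⟨D, h3.trans hVU, h1, h2, h4⟩

theorem int_dep {α β : Type*} [Fintype α] [Fintype β] (A : α → β → ℤ)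
    (h : Fintype.card α < Fintype.card β) : ∃ t : β → ℤ, t ≠ 0 ∧ ∀ a, ∑ b, t b * A a b = 0 := by
  rcases Nat.eq_zero_or_pos (Fintype.card α) with h0 | h0
  · have := Fintype.card_eq_zero_iff.1 h0
    have hne : Nonempty β := Fintype.card_pos_iff.1 (by omega)
    refine ⟨fun _ => 1, ?_, fun a => (IsEmpty.false a).elim⟩
    obtain ⟨b⟩ := hne
    intro hb
    exact one_ne_zero (congrFun hb b)
  · obtain ⟨t, ht, h1, -⟩ := Int.Matrix.exists_ne_zero_int_vec_norm_le (Matrix.of A) h h0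
    refine ⟨t, ht, fun a => ?_⟩
    have := congrFun h1 a
    simp only [Matrix.mulVec, dotProduct, Matrix.of_apply, Pi.zero_apply] at this
    rw [← this]
    exact Finset.sum_congr rfl fun b _ => mul_comm _ _

theorem rank_lemma {S : Type*} [MetricSpace S] (hS : LocallyEuclidean2 S) {Q G : Set S}
    (hQ : IsCompact Q) (hG : IsOpen G) (hQG : Q ⊆ G) :
    ∃ N : ℕ, ∀ (J I : Type) [Fintype J] [Fintype I], Fintype.card I * N < Fintype.card J →
      ∀ f : J → I → S → ℂ, (∀ j i, ContinuousOn (f j i) G) → (∀ j i, ∀ x ∈ G, f j i x ≠ 0) →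
        ∃ n : J → ℤ, n ≠ 0 ∧ ∀ i, ∃ φ : S → ℂ, ContinuousOn φ Q ∧
          ∀ x ∈ Q, ex (φ x) = ∏ j, f j i x ^ n j := by
  classical
  have := locConn hS
  have hD : ∀ x : G, ∃ D, IsOpen D ∧ (x : S) ∈ D ∧ D ⊆ G ∧ HasLogs D := fun x => by
    obtain ⟨D, h1, h2, h3, h4, -⟩ := local_disc hS hG x.2
    exact ⟨D, h1, h2, h3, h4⟩
  choose D hDo hxD hDG hDL using hD
  obtain ⟨δ, hδ, hδ'⟩ := lebesgue_number_lemma_of_metric hQ hDo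
    (fun x hx => mem_iUnion.2 ⟨⟨x, hQG hx⟩, hxD _⟩)
  let E : S → Set S := fun x => connectedComponentIn (ball x (δ / 4)) x
  have hEo : ∀ x, IsOpen (E x) := fun x => isOpen_ball.connectedComponentIn
  have hEx : ∀ x, x ∈ E x := fun x => mem_connectedComponentIn (mem_ball_self (by linarith))
  have hEb : ∀ x, E x ⊆ ball x (δ / 4) := fun x => connectedComponentIn_subset _ _
  have hEp : ∀ x, IsPreconnected (E x) := fun x => isPreconnected_connectedComponentIn
  obtain ⟨t, htQ, hcov⟩ := hQ.elim_nhds_subcover E (fun x _ => (hEo x).mem_nhds (hEx x))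
  refine ⟨Fintype.card (t × t), fun J I _ _ hcard f hf hf0 => ?_⟩
  -- lifts on balls
  have hlift : ∀ (j : J) (i : I) (a : t), ∃ F : S → ℂ, ContinuousOn F (ball (a : S) δ) ∧
      ∀ x ∈ ball (a : S) δ, ex (F x) = f j i x := by
    intro j i a
    obtain ⟨y, hy⟩ := hδ' a (htQ a a.2)
    obtain ⟨F, hF, hF'⟩ := hDL y (f j i) ((hf j i).mono (hDG y))
      (fun x hx => hf0 j i x (hDG y hx))
    exact ⟨F, hF.mono hy, fun x hx => hF' x (hy hx)⟩
  choose F hF hF' using hlift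
  have hball : ∀ a : t, E a ⊆ ball (a : S) δ := fun a =>
    (hEb a).trans (ball_subset_ball (by linarith))
  have hball2 : ∀ a b : t, (E a ∩ E b).Nonempty → E b ⊆ ball (a : S) δ := by
    rintro a b ⟨z, hz1, hz2⟩ y hy
    have h1 := mem_ball.1 (hEb _ hz1)
    have h2 := mem_ball.1 (hEb _ hz2)
    have h3 := mem_ball.1 (hEb _ hy)
    rw [mem_ball]
    have h4 := dist_triangle y b a
    have h5 := dist_triangle_left (b : S) a z
    linarith
  have hk : ∀ (j : J) (i : I) (a b : t), ∃ k : ℤ, ∀ z ∈ E a ∩ E b, F j i a z - F j i b z = k := by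
    intro j i a b
    by_cases hne : (E a ∩ E b).Nonempty
    · have hsub := hball2 a b hne
      have hc : ContinuousOn (fun z => F j i a z - F j i b z) (E b) :=
        ((hF j i a).mono hsub).sub ((hF j i b).mono (hball b))
      have h1 : ∀ z ∈ E b, ex (F j i a z - F j i b z) = 1 := by
        intro z hz
        rw [ex_sub, hF' j i a z (hsub hz), hF' j i b z (hball b hz), div_self]
        rw [← hF' j i b z (hball b hz)]
        exact ex_ne_zero _
      obtain ⟨k, hk⟩ := (ex_eq_one_iff _).1 (h1 b (hEx b))
      refine ⟨k, fun z hz => ?_⟩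
      rw [← hk]
      exact ex_const (hEp b) hc h1 hz.2 (hEx b)
    · exact ⟨0, fun z hz => absurd ⟨z, hz⟩ hne⟩
  choose k hk using hk
  obtain ⟨n, hn, hn'⟩ := int_dep (fun (p : I × (t × t)) (j : J) => k j p.1 p.2.1 p.2.2)
    (by rw [Fintype.card_prod]; exact hcard)
  refine ⟨n, hn, fun i => ?_⟩
  have hsel : ∀ x : S, ∃ a : S, x ∈ Q → a ∈ t ∧ x ∈ E a := by
    intro x
    by_cases hx : x ∈ Q
    · obtain ⟨a, ha, hxa⟩ := mem_iUnion₂.1 (hcov hx)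
      exact ⟨a, fun _ => ⟨ha, hxa⟩⟩
    · exact ⟨x, fun h => absurd h hx⟩
  choose s hs using hsel
  let φ : S → ℂ := fun x => if h : s x ∈ t then ∑ j, n j * F j i ⟨s x, h⟩ x else 0
  have hφ : ∀ (a : t), ∀ x ∈ Q ∩ E a, φ x = ∑ j, n j * F j i a x := by
    intro a x hx
    have h1 := hs x hx.1
    simp only [φ, dif_pos h1.1]
    rw [← sub_eq_zero, ← Finset.sum_sub_distrib]
    have h2 := hn' (i, (⟨s x, h1.1⟩, a))
    have h3 : (((∑ j, n j * k j i ⟨s x, h1.1⟩ a : ℤ)) : ℂ) = 0 := by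
      exact_mod_cast h2
    rw [← h3]
    push_cast
    refine Finset.sum_congr rfl fun j _ => ?_
    rw [← hk j i ⟨s x, h1.1⟩ a x ⟨h1.2, hx.2⟩]
    ring
  refine ⟨φ, ?_, ?_⟩
  · intro x hx
    have h1 := hs x hx
    have hc : ContinuousOn (fun y => ∑ j, n j * F j i ⟨s x, h1.1⟩ y) (E (s x)) := by
      refine continuousOn_finsetSum _ fun j _ => continuousOn_const.mul ?_
      exact (hF j i ⟨s x, h1.1⟩).mono (hball ⟨s x, h1.1⟩)
    have hca := hc.continuousAt ((hEo _).mem_nhds h1.2)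
    refine hca.continuousWithinAt.congr_of_eventuallyEq ?_ ?_
    · filter_upwards [self_mem_nhdsWithin, mem_nhdsWithin_of_mem_nhds ((hEo _).mem_nhds h1.2)]
        with y hy hy'
      exact hφ ⟨s x, h1.1⟩ y ⟨hy, hy'⟩
    · exact hφ ⟨s x, h1.1⟩ x ⟨hx, h1.2⟩
  · intro x hx
    have h1 := hs x hx
    rw [hφ ⟨s x, h1.1⟩ x ⟨hx, h1.2⟩, ex_sum]
    refine Finset.prod_congr rfl fun j _ => ?_
    rw [ex_int_mul, hF' j i ⟨s x, h1.1⟩ x (hball ⟨s x, h1.1⟩ h1.2)]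


section Indec

variable {S : Type*} [MetricSpace S]

/-- Two points are related if they lie in a common proper subcontinuum. -/
def CRel (X : Set S) (x y : S) : Prop := ∃ A, IsProperSubcontinuum X A ∧ x ∈ A ∧ y ∈ A

theorem CRel.symm {X : Set S} {x y : S} (h : CRel X x y) : CRel X y x := by
  obtain ⟨A, h1, h2, h3⟩ := h
  exact ⟨A, h1, h3, h2⟩

theorem union_proper {X A B : Set S} (hind : ¬ IsDecomposable X) (hA : IsProperSubcontinuum X A)
    (hB : IsProperSubcontinuum X B) (h : (A ∩ B).Nonempty) : IsProperSubcontinuum X (A ∪ B) := by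
  refine ⟨hA.1.mono subset_union_left, hA.2.1.union hB.2.1, hA.2.2.1.union h hB.2.2.1,
    union_subset hA.2.2.2.1 hB.2.2.2.1, fun he => hind ⟨A, B, hA, hB, he⟩⟩

theorem CRel.trans {X : Set S} (hind : ¬ IsDecomposable X) {x y z : S} (h : CRel X x y)
    (h' : CRel X y z) : CRel X x z := by
  obtain ⟨A, h1, h2, h3⟩ := h
  obtain ⟨B, g1, g2, g3⟩ := h'
  exact ⟨A ∪ B, union_proper hind h1 g1 ⟨y, h3, g2⟩, Or.inl h2, Or.inr g3⟩

theorem CRel.refl {X : Set S} (hnt : X.Nontrivial) {x : S} (hx : x ∈ X) : CRel X x x := by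
  refine ⟨{x}, ⟨singleton_nonempty x, isClosed_singleton, isConnected_singleton,
    singleton_subset_iff.2 hx, fun h => ?_⟩, rfl, rfl⟩
  rw [← h] at hnt
  exact not_nontrivial_singleton hnt

theorem clopen_sep {Y : Type*} [TopologicalSpace Y] [CompactSpace Y] [T2Space Y] {y : Y}
    {B : Set Y} (hB : IsClosed B) (h : Disjoint (connectedComponent y) B) :
    ∃ Z, IsClopen Z ∧ y ∈ Z ∧ Disjoint Z B := by
  rw [connectedComponent_eq_iInter_isClopen] at h
  have h1 : ∀ b ∈ B, ∃ Z : Set Y, IsClopen Z ∧ y ∈ Z ∧ b ∉ Z := by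
    intro b hb
    have := disjoint_right.1 h hb
    simp only [mem_iInter, Subtype.forall, not_forall] at this
    obtain ⟨Z, ⟨h1, h2⟩, h3⟩ := this
    exact ⟨Z, h1, h2, h3⟩
  choose! Z hZ1 hZ2 hZ3 using h1
  obtain ⟨t, ht, htc⟩ := hB.isCompact.elim_nhds_subcover (fun b => (Z b)ᶜ)
    (fun b hb => (hZ1 b hb).compl.isOpen.mem_nhds (hZ3 b hb))
  refine ⟨⋂ b ∈ t, Z b, isClopen_biInter_finset fun b hb => hZ1 b (ht b hb),
    mem_iInter₂.2 fun b hb => hZ2 b (ht b hb), ?_⟩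
  rw [disjoint_right]
  intro b hb hb'
  obtain ⟨c, hc, hbc⟩ := mem_iUnion₂.1 (htc hb)
  exact hbc (mem_iInter₂.1 hb' c hc)

/-- Clopen separation inside a compact set. -/
theorem clopen_sep_in {T B : Set S} (hT : IsCompact T) (hB : IsClosed B) {x : S} (hx : x ∈ T)
    (h : Disjoint (connectedComponentIn T x) B) :
    ∃ P R, IsClosed P ∧ IsClosed R ∧ Disjoint P R ∧ P ∪ R = T ∧ x ∈ P ∧ Disjoint P B := by
  have : CompactSpace T := isCompact_iff_compactSpace.1 hT
  obtain ⟨Z, hZ, hxZ, hZB⟩ := clopen_sep (y := (⟨x, hx⟩ : T))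
    (hB.preimage continuous_subtype_val) (by
      rw [disjoint_left]
      intro z hz hzB
      rw [connectedComponentIn_eq_image hx] at h
      exact disjoint_left.1 h (mem_image_of_mem _ hz) hzB)
  have hcl := hT.isClosed.isClosedEmbedding_subtypeVal
  refine ⟨Subtype.val '' Z, Subtype.val '' Zᶜ, hcl.isClosedMap _ hZ.isClosed,
    hcl.isClosedMap _ hZ.compl.isClosed, ?_, ?_, ⟨_, hxZ, rfl⟩, ?_⟩
  · exact (disjoint_image_iff Subtype.val_injective).2 disjoint_compl_right
  · rw [← image_union, union_compl_self, image_univ, Subtype.range_coe]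
  · rw [disjoint_left]
    rintro _ ⟨z, hz, rfl⟩ hzB
    exact disjoint_left.1 hZB hz hzB

theorem isClosed_compIn {T : Set S} (hT : IsClosed T) (x : S) :
    IsClosed (connectedComponentIn T x) := by
  by_cases hx : x ∈ T
  · refine isClosed_of_closure_subset ?_
    exact isPreconnected_connectedComponentIn.closure.subset_connectedComponentIn
      (subset_closure (mem_connectedComponentIn hx))
      (closure_minimal (connectedComponentIn_subset _ _) hT)
  · rw [connectedComponentIn_eq_empty hx]
    exact isClosed_empty

theorem comp_proper {X W : Set S} (hX : IsContinuum X) (hW : IsOpen W) (hWX : (X ∩ W).Nonempty)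
    {x : S} (hx : x ∈ X) (hxW : x ∉ W) :
    IsProperSubcontinuum X (connectedComponentIn (X \ W) x) := by
  have hx' : x ∈ X \ W := ⟨hx, hxW⟩
  refine ⟨⟨x, mem_connectedComponentIn hx'⟩,
    isClosed_compIn (hX.1.isClosed.sdiff hW) x,
    isConnected_connectedComponentIn_iff.2 hx', (connectedComponentIn_subset _ _).trans
    sdiff_subset, fun h => ?_⟩
  obtain ⟨p, hp, hpW⟩ := hWX
  rw [← h] at hp
  exact (connectedComponentIn_subset _ _ hp).2 hpW

theorem SEP {X W : Set S} (hX : IsContinuum X) (hW : IsOpen W) (hWX : (X ∩ W).Nonempty) {x y : S}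
    (hx : x ∈ X) (hy : y ∈ X) (hxW : x ∉ W) (hyW : y ∉ W) (hxy : ¬ CRel X x y) :
    ∃ P R, IsClosed P ∧ IsClosed R ∧ Disjoint P R ∧ P ∪ R = X \ W ∧ x ∈ P ∧ y ∈ R := by
  have hT : IsCompact (X \ W) := hX.1.diff hW
  obtain ⟨P, R, h1, h2, h3, h4, h5, h6⟩ := clopen_sep_in hT (B := {y}) isClosed_singleton
    ⟨hx, hxW⟩ (by
      rw [disjoint_singleton_right]
      intro h
      exact hxy ⟨_, comp_proper hX hW hWX hx hxW, mem_connectedComponentIn ⟨hx, hxW⟩, h⟩)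
  refine ⟨P, R, h1, h2, h3, h4, h5, ?_⟩
  have : y ∈ P ∪ R := by rw [h4]; exact ⟨hy, hyW⟩
  exact this.resolve_left (fun h => disjoint_singleton_right.1 h6 h)

/-- Boundary bumping: every class meets every open set meeting `X`. -/
theorem class_meets {X O : Set S} (hX : IsContinuum X) (hnt : X.Nontrivial) (hO : IsOpen O)
    (hOX : (X ∩ O).Nonempty)
    {x : S} (hx : x ∈ X) : ∃ A, IsProperSubcontinuum X A ∧ x ∈ A ∧ (A ∩ O).Nonempty := by
  by_cases hxO : x ∈ O
  · obtain ⟨A, h1, h2, -⟩ := CRel.refl hnt hx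
    exact ⟨A, h1, h2, x, h2, hxO⟩
  obtain ⟨p, hpX, hpO⟩ := hOX
  obtain ⟨ε, hε, hball⟩ := Metric.isOpen_iff.1 hO p hpO
  set W := ball p (ε / 2) with hW
  have hpW : p ∈ W := mem_ball_self (by linarith)
  have hcW : closure W ⊆ O :=
    (closure_ball_subset_closedBall.trans (closedBall_subset_ball (by linarith))).trans hball
  have hxW : x ∉ W := fun h => hxO (hcW (subset_closure h))
  have hWX : (X ∩ W).Nonempty := ⟨p, hpX, hpW⟩
  refine ⟨_, comp_proper hX isOpen_ball hWX hx hxW, mem_connectedComponentIn ⟨hx, hxW⟩, ?_⟩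
  by_contra hno
  have hdis : Disjoint (connectedComponentIn (X \ W) x) (closure W) := by
    rw [disjoint_left]
    exact fun z hz hzW => hno ⟨z, hz, hcW hzW⟩
  obtain ⟨P, R, h1, h2, h3, h4, h5, h6⟩ :=
    clopen_sep_in (hX.1.diff isOpen_ball) isClosed_closure (x := x) ⟨hx, hxW⟩ hdis
  have hXs := hX.2.isPreconnected
  rw [isPreconnected_closed_iff] at hXs
  obtain ⟨z, hzX, hzP, hzR⟩ := hXs P (R ∪ closure W) h1 (h2.union isClosed_closure) (by
      intro z hz
      by_cases hzW : z ∈ W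
      · exact Or.inr (Or.inr (subset_closure hzW))
      · have : z ∈ P ∪ R := by rw [h4]; exact ⟨hz, hzW⟩
        exact this.elim Or.inl (fun h => Or.inr (Or.inl h)))
    ⟨x, hx, h5⟩ ⟨p, hpX, Or.inr (subset_closure hpW)⟩
  rcases hzR with h | h
  · exact disjoint_left.1 h3 hzP h
  · exact disjoint_left.1 h6 hzP h

theorem conn_union_part {X A U V : Set S} (hX : IsPreconnected X) (hA : IsPreconnected A)
    (hAne : A.Nonempty) (hAX : A ⊆ X) (hU : IsOpen U) (hV : IsOpen V) (hUV : X \ A ⊆ U ∪ V)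
    (hdis : ¬ ((X \ A) ∩ (U ∩ V)).Nonempty) : IsPreconnected (A ∪ ((X \ A) ∩ U)) := by
  have key : ∀ O1 O2 : Set S, IsOpen O1 → IsOpen O2 → A ∪ ((X \ A) ∩ U) ⊆ O1 ∪ O2 →
      (A ∩ O1).Nonempty → ((A ∪ ((X \ A) ∩ U)) ∩ O2).Nonempty →
      ((A ∪ ((X \ A) ∩ U)) ∩ (O1 ∩ O2)).Nonempty := by
    intro O1 O2 h1 h2 hcov hAO1 hO2
    by_contra hcon
    have hAO2 : ∀ z ∈ A, z ∉ O2 := by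
      intro z hz hzO
      obtain ⟨w, hw, hw'⟩ := hA O1 O2 h1 h2 (subset_union_left.trans hcov) hAO1 ⟨z, hz, hzO⟩
      exact hcon ⟨w, Or.inl hw, hw'⟩
    have hAO1' : ∀ z ∈ A, z ∈ O1 := fun z hz => (hcov (Or.inl hz)).resolve_right (hAO2 z hz)
    obtain ⟨z, hz, hz2⟩ := hO2
    have hz' : z ∈ (X \ A) ∩ U := hz.resolve_left (fun h => hAO2 z h hz2)
    obtain ⟨a, ha⟩ := hAne
    obtain ⟨w, hwX, ⟨hw2, hwU⟩, hw⟩ := hX (O2 ∩ U) (O1 ∪ V) (h2.inter hU) (h1.union hV) (by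
        intro y hy
        by_cases hyA : y ∈ A
        · exact Or.inr (Or.inl (hAO1' y hyA))
        · rcases hUV ⟨hy, hyA⟩ with h | h
          · rcases hcov (Or.inr ⟨⟨hy, hyA⟩, h⟩) with h' | h'
            · exact Or.inr (Or.inl h')
            · exact Or.inl ⟨h', h⟩
          · exact Or.inr (Or.inr h))
      ⟨z, hz'.1.1, hz2, hz'.2⟩ ⟨a, hAX ha, Or.inl (hAO1' a ha)⟩
    have hwA : w ∉ A := fun h => hAO2 w h hw2
    rcases hw with h | h
    · exact hcon ⟨w, Or.inr ⟨⟨hwX, hwA⟩, hwU⟩, h, hw2⟩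
    · exact hdis ⟨w, ⟨hwX, hwA⟩, hwU, h⟩
  intro O1 O2 h1 h2 hcov hO1 hO2
  obtain ⟨a, ha⟩ := hAne
  rcases hcov (Or.inl ha) with h | h
  · exact key O1 O2 h1 h2 hcov ⟨a, ha, h⟩ hO2
  · rw [inter_comm O1]
    exact key O2 O1 h2 h1 (by rwa [union_comm O2]) ⟨a, ha, h⟩ hO1

/-- Proper subcontinua of an indecomposable continuum are nowhere dense. -/
theorem proper_nowhere {X A : Set S} (hX : IsContinuum X) (hind : ¬ IsDecomposable X)
    (hA : IsProperSubcontinuum X A) : X ⊆ closure (X \ A) := by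
  obtain ⟨hne, hcl, hcon, hAX, hneX⟩ := hA
  have hXA : (X \ A).Nonempty := by
    rw [nonempty_iff_ne_empty]
    intro h
    exact hneX (hAX.antisymm (sdiff_eq_empty.1 h))
  by_cases hc : IsPreconnected (X \ A)
  · by_contra hns
    have hsub : closure (X \ A) ⊆ X := closure_minimal sdiff_subset hX.1.isClosed
    refine hind ⟨A, closure (X \ A), ⟨hne, hcl, hcon, hAX, hneX⟩,
      ⟨hXA.closure, isClosed_closure, ⟨hXA.closure, hc.closure⟩, hsub,
        fun h => hns h.symm.subset⟩, ?_⟩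
    refine (union_subset hAX hsub).antisymm fun z hz => ?_
    by_cases hzA : z ∈ A
    · exact Or.inl hzA
    · exact Or.inr (subset_closure ⟨hz, hzA⟩)
  · exfalso
    unfold IsPreconnected at hc
    push Not at hc
    obtain ⟨U, V, hU, hV, hUV, h1, h2, h3⟩ := hc
    have h3' : ¬ ((X \ A) ∩ (U ∩ V)).Nonempty := by rw [h3]; exact not_nonempty_empty
    have h3'' : ¬ ((X \ A) ∩ (V ∩ U)).Nonempty := by rwa [inter_comm V]
    have hp : ∀ U V : Set S, IsOpen U → IsOpen V → X \ A ⊆ U ∪ V → ((X \ A) ∩ V).Nonempty →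
        ¬ ((X \ A) ∩ (U ∩ V)).Nonempty → IsProperSubcontinuum X (A ∪ ((X \ A) ∩ U)) := by
      intro U V hU hV hUV h2 h3'
      have e : A ∪ ((X \ A) ∩ U) = A ∪ (X \ V) := by
        ext z
        constructor
        · rintro (h | ⟨h, hu⟩)
          · exact Or.inl h
          · exact Or.inr ⟨h.1, fun hv => h3' ⟨z, h, hu, hv⟩⟩
        · rintro (h | ⟨h, hv⟩)
          · exact Or.inl h
          · by_cases hzA : z ∈ A
            · exact Or.inl hzA
            · exact Or.inr ⟨⟨h, hzA⟩, (hUV ⟨h, hzA⟩).resolve_right hv⟩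
      refine ⟨hne.mono subset_union_left, ?_, ⟨hne.mono subset_union_left,
        conn_union_part hX.2.isPreconnected hcon.isPreconnected hne hAX hU hV hUV h3'⟩, ?_, ?_⟩
      · rw [e]
        exact hcl.union (hX.1.isClosed.sdiff hV)
      · exact union_subset hAX (inter_subset_left.trans sdiff_subset)
      · intro h
        obtain ⟨z, hz, hzV⟩ := h2
        have : z ∈ A ∪ ((X \ A) ∩ U) := by rw [h]; exact hz.1
        rcases this with h | h
        · exact hz.2 h
        · exact h3' ⟨z, hz, h.2, hzV⟩
    refine hind ⟨_, _, hp U V hU hV hUV h2 h3', hp V U hV hU (by rwa [union_comm V]) h1 h3'', ?_⟩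
    apply Subset.antisymm
    · exact union_subset (union_subset hAX (inter_subset_left.trans sdiff_subset))
        (union_subset hAX (inter_subset_left.trans sdiff_subset))
    · intro z hz
      by_cases hzA : z ∈ A
      · exact Or.inl (Or.inl hzA)
      · rcases hUV ⟨hz, hzA⟩ with h | h
        · exact Or.inl (Or.inr ⟨⟨hz, hzA⟩, h⟩)
        · exact Or.inr (Or.inr ⟨⟨hz, hzA⟩, h⟩)

theorem baire_avoid {X : Set S} (hX : IsContinuum X) (hind : ¬ IsDecomposable X)
    {C : Set (Set S)} (hC : C.Countable) (hCp : ∀ A ∈ C, IsProperSubcontinuum X A) :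
    ∃ x ∈ X, ∀ A ∈ C, x ∉ A := by
  have : CompactSpace X := isCompact_iff_compactSpace.1 hX.1
  have hne : Nonempty X := hX.2.nonempty.to_subtype
  have hd : Dense (⋂ A ∈ C, (Subtype.val ⁻¹' Aᶜ : Set X)) := by
    refine dense_biInter_of_isOpen (fun A hA => ?_) hC (fun A hA => ?_)
    · exact (hCp A hA).2.1.isOpen_compl.preimage continuous_subtype_val
    · intro x
      have := proper_nowhere hX hind (hCp A hA) x.2
      rw [closure_subtype]
      convert this using 2
      ext z
      simp
  obtain ⟨x, hx⟩ := hd.nonempty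
  exact ⟨x, x.2, fun A hA h => mem_iInter₂.1 hx A hA h⟩

theorem class_countable [SecondCountableTopology S] {X : Set S} (hX : IsContinuum X) {x : S}
    (hx : x ∈ X) : ∃ C : Set (Set S), C.Countable ∧ (∀ A ∈ C, IsProperSubcontinuum X A) ∧
      ∀ y, CRel X x y → ∃ A ∈ C, y ∈ A := by
  have hb := TopologicalSpace.isBasis_countableBasis S
  refine ⟨(fun W => connectedComponentIn (X \ W) x) ''
    {W ∈ TopologicalSpace.countableBasis S | (X ∩ W).Nonempty ∧ x ∉ W}, ?_, ?_, ?_⟩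
  · exact ((TopologicalSpace.countable_countableBasis S).mono (sep_subset _ _)).image _
  · rintro _ ⟨W, ⟨hW, h1, h2⟩, rfl⟩
    exact comp_proper hX (hb.isOpen hW) h1 hx h2
  · rintro y ⟨A, ⟨-, hcl, hcon, hAX, hne⟩, hxA, hyA⟩
    obtain ⟨p, hp, hpA⟩ : ∃ p ∈ X, p ∉ A := by
      by_contra h
      push Not at h
      exact hne (hAX.antisymm h)
    obtain ⟨W, hW, hpW, hWA⟩ := hb.exists_subset_of_mem_open (show p ∈ Aᶜ from hpA)
      hcl.isOpen_compl
    refine ⟨_, ⟨W, ⟨hW, ⟨p, hp, hpW⟩, fun h => hWA h hxA⟩, rfl⟩, ?_⟩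
    refine hcon.isPreconnected.subset_connectedComponentIn hxA ?_ hyA
    exact fun z hz => ⟨hAX hz, fun h => hWA h hz⟩

theorem avoid_classes [SecondCountableTopology S] {X : Set S} (hX : IsContinuum X)
    (hind : ¬ IsDecomposable X) {Y : Set S} (hY : Y.Countable) (hYX : Y ⊆ X) :
    ∃ x ∈ X, ∀ y ∈ Y, ¬ CRel X y x := by
  have h1 : ∀ y ∈ Y, ∃ C : Set (Set S), C.Countable ∧ (∀ A ∈ C, IsProperSubcontinuum X A) ∧
      ∀ z, CRel X y z → ∃ A ∈ C, z ∈ A := fun y hy => class_countable hX (hYX hy)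
  choose! C hC1 hC2 hC3 using h1
  obtain ⟨x, hx, hx'⟩ := baire_avoid hX hind (C := ⋃ y ∈ Y, C y) (hY.biUnion hC1) (by
    intro A hA
    obtain ⟨y, hy, hA⟩ := mem_iUnion₂.1 hA
    exact hC2 y hy A hA)
  refine ⟨x, hx, fun y hy h => ?_⟩
  obtain ⟨A, hA, hxA⟩ := hC3 y hy x h
  exact hx' A (mem_iUnion₂.2 ⟨y, hy, hA⟩) hxA

theorem many_classes [SecondCountableTopology S] {X : Set S} (hX : IsContinuum X)
    (hind : ¬ IsDecomposable X) (hnt : X.Nontrivial) {x0 : S} (hx0 : x0 ∈ X) :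
    ∃ Y, ¬ Y.Countable ∧ Y ⊆ X ∧ (Y.Pairwise fun a b => ¬ CRel X a b) ∧
      ∀ y ∈ Y, ¬ CRel X x0 y := by
  let s : Setoid X := ⟨fun a b => CRel X a b, ⟨fun a => CRel.refl hnt a.2, fun h => h.symm,
    fun h h' => h.trans hind h'⟩⟩
  let o : Quotient s → X := Quotient.out
  let Y : Set S := {y | (∃ c, (o c : S) = y) ∧ ¬ CRel X x0 y}
  have hYX : Y ⊆ X := by
    rintro y ⟨⟨c, rfl⟩, -⟩
    exact (o c).2
  refine ⟨Y, ?_, hYX, ?_, fun y hy => hy.2⟩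
  · intro hc
    obtain ⟨x, hx, hx'⟩ := avoid_classes hX hind (hc.insert x0) (insert_subset hx0 hYX)
    have hr : CRel X (o (Quotient.mk s ⟨x, hx⟩)) x := Quotient.mk_out (s := s) (⟨x, hx⟩ : X)
    refine hx' _ (Or.inr ⟨⟨_, rfl⟩, fun h => ?_⟩) hr
    exact hx' x0 (Or.inl rfl) (h.trans hind hr)
  · rintro _ ⟨⟨c, rfl⟩, -⟩ _ ⟨⟨d, rfl⟩, -⟩ hne h
    apply hne
    have : c = d := by
      rw [← Quotient.out_eq c, ← Quotient.out_eq d]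
      exact Quotient.sound h
    rw [this]

theorem INF [SecondCountableTopology S] {X : Set S} (hX : IsContinuum X)
    (hind : ¬ IsDecomposable X) (hnt : X.Nontrivial) {x0 : S} (hx0 : x0 ∈ X) {ι : Type*} [Finite ι]
    (B : ι → Set S) (hB : ∀ i, IsOpen (B i)) (hBX : ∀ i, (X ∩ B i).Nonempty) {ρ0 : ℝ}
    (hρ0 : 0 < ρ0) :
    ∃ ρ, 0 < ρ ∧ ρ < ρ0 ∧ ∃ Y, Y.Infinite ∧ Y ⊆ X ∧ (Y.Pairwise fun a b => ¬ CRel X a b) ∧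
      ∀ y ∈ Y, ∃ C, y ∈ C ∧ IsPreconnected C ∧ C ⊆ X \ ball x0 ρ ∧ ∀ i, (C ∩ B i).Nonempty := by
  obtain ⟨Y, hYc, hYX, hYp, hY0⟩ := many_classes hX hind hnt hx0
  have hex : ∀ y ∈ Y, ∃ n : ℕ, ∃ C, y ∈ C ∧ IsPreconnected C ∧
      C ⊆ X \ ball x0 (1 / ((n : ℝ) + 1)) ∧ ∀ i, (C ∩ B i).Nonempty := by
    intro y hy
    choose A hA hyA hAB using fun i => class_meets hX hnt (hB i) (hBX i) (hYX hy)
    have hcl : IsClosed ({y} ∪ ⋃ i, A i) :=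
      isClosed_singleton.union (isClosed_iUnion_of_finite fun i => (hA i).2.1)
    have hx0n : x0 ∉ {y} ∪ ⋃ i, A i := by
      rintro (h | h)
      · rw [mem_singleton_iff] at h
        subst h
        exact hY0 _ hy (CRel.refl hnt hx0)
      · obtain ⟨i, hi⟩ := mem_iUnion.1 h
        exact hY0 y hy ⟨A i, hA i, hi, hyA i⟩
    obtain ⟨ε, hε, hεb⟩ := Metric.isOpen_iff.1 hcl.isOpen_compl x0 hx0n
    obtain ⟨n, hn⟩ := exists_nat_one_div_lt hε
    refine ⟨n, {y} ∪ ⋃ i, A i, Or.inl rfl, ?_, ?_, ?_⟩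
    · have : {y} ∪ ⋃ i, A i = ⋃ o : Option ι, (o.elim {y} A) := by
        rw [iUnion_option]
        rfl
      rw [this]
      refine isPreconnected_iUnion (s := fun o : Option ι => o.elim {y} A)
        ⟨y, mem_iInter.2 ?_⟩ ?_
      · rintro (_ | i)
        · exact rfl
        · exact hyA i
      · rintro (_ | i)
        · exact isPreconnected_singleton
        · exact (hA i).2.2.1.isPreconnected
    · intro z hz
      refine ⟨?_, fun hzb => hεb (ball_subset_ball hn.le hzb) hz⟩
      rcases hz with h | h
      · rw [mem_singleton_iff] at h
        subst h
        exact hYX hy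
      · obtain ⟨i, hi⟩ := mem_iUnion.1 h
        exact (hA i).2.2.2.1 hi
    · intro i
      obtain ⟨z, hz, hzB⟩ := hAB i
      exact ⟨z, Or.inr (mem_iUnion.2 ⟨i, hz⟩), hzB⟩
  choose! n C h1 h2 h3 h4 using hex
  have hm : ∃ m, ¬ {y ∈ Y | n y = m}.Countable := by
    by_contra hcon
    push Not at hcon
    apply hYc
    have : Y = ⋃ m, {y ∈ Y | n y = m} := by
      ext y
      simp
    rw [this]
    exact countable_iUnion hcon
  obtain ⟨m, hm⟩ := hm
  have hpos : (0:ℝ) < 1 / ((m : ℝ) + 1) := by positivity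
  refine ⟨min (1 / ((m : ℝ) + 1)) (ρ0 / 2), lt_min hpos (by linarith),
    lt_of_le_of_lt (min_le_right _ _) (by linarith), {y ∈ Y | n y = m},
    fun h => hm h.countable, (sep_subset _ _).trans hYX, hYp.mono (sep_subset _ _), ?_⟩
  rintro y ⟨hy, rfl⟩
  refine ⟨C y, h1 y hy, h2 y hy, (h3 y hy).trans ?_, h4 y hy⟩
  exact sdiff_subset_sdiff_right (ball_subset_ball (min_le_left _ _))

/-- Density of one of boundedly many connected pieces. -/
theorem lemmaL [SecondCountableTopology S] {X : Set S} (hX : IsContinuum X)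
    (hind : ¬ IsDecomposable X) (hnt : X.Nontrivial) {ε : ℝ} (hε : 0 < ε) (r : ℕ) :
    ∃ δ > 0, ∀ (ι : Type) [Fintype ι], Fintype.card ι ≤ r → ∀ F : ι → Set S,
      (∀ i, IsPreconnected (F i)) → (∀ i, F i ⊆ X) →
      (∀ x ∈ X, ∃ i, ∃ y ∈ F i, dist x y < δ) → ∃ i, ∀ x ∈ X, ∃ y ∈ F i, dist x y < ε := by
  classical
  obtain ⟨x0, hx0⟩ := hX.2.nonempty
  obtain ⟨Y, hYc, hYX, hYp, -⟩ := many_classes hX hind hnt hx0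
  have hYi : Y.Infinite := fun h => hYc h.countable
  obtain ⟨t, htY, htc⟩ := hYi.exists_subset_card_eq (r + 1)
  -- finite net
  obtain ⟨N, hNX, hNf, hNc⟩ := hX.1.finite_cover_balls (half_pos hε)
  have : Finite N := hNf
  -- for each pair and net point, a good delta
  have key : ∀ (a b : t) (p : N), a ≠ b → ∃ δ > 0, ∀ F : Set S, IsPreconnected F → F ⊆ X →
      Disjoint F (ball (p : S) (ε / 2)) → (∃ y ∈ F, dist (a : S) y < δ) →
      (∃ y ∈ F, dist (b : S) y < δ) → False := by
    intro a b p hab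
    set W := ball (p : S) (ε / 2) with hW
    by_cases haW : (a : S) ∈ W
    · obtain ⟨δ, hδ, hb⟩ := Metric.isOpen_iff.1 isOpen_ball _ haW
      refine ⟨δ, hδ, fun F _ _ hd ⟨y, hy, hay⟩ _ => ?_⟩
      exact disjoint_left.1 hd hy (hb (by rw [mem_ball, dist_comm]; exact hay))
    by_cases hbW : (b : S) ∈ W
    · obtain ⟨δ, hδ, hb⟩ := Metric.isOpen_iff.1 isOpen_ball _ hbW
      refine ⟨δ, hδ, fun F _ _ hd _ ⟨y, hy, hay⟩ => ?_⟩
      exact disjoint_left.1 hd hy (hb (by rw [mem_ball, dist_comm]; exact hay))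
    obtain ⟨P, R, hP, hR, hPR, hPRe, haP, hbR⟩ := SEP hX (W := W) isOpen_ball
      ⟨p, hNX p.2, mem_ball_self (half_pos hε)⟩ (hYX (htY a.2)) (hYX (htY b.2)) haW hbW
      (hYp (htY a.2) (htY b.2) (fun h => hab (Subtype.ext h)))
    obtain ⟨δ1, hδ1, hb1⟩ := Metric.isOpen_iff.1 hR.isOpen_compl a (disjoint_left.1 hPR haP)
    obtain ⟨δ2, hδ2, hb2⟩ := Metric.isOpen_iff.1 hP.isOpen_compl b (disjoint_right.1 hPR hbR)
    refine ⟨min δ1 δ2, lt_min hδ1 hδ2, ?_⟩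
    rintro F hF hFX hd ⟨y, hy, hay⟩ ⟨z, hz, hbz⟩
    have hsub : F ⊆ P ∪ R := by
      rw [hPRe]
      exact fun w hw => ⟨hFX hw, disjoint_left.1 hd hw⟩
    have hyR : y ∉ R := hb1 (by
      rw [mem_ball, dist_comm]; exact hay.trans_le (min_le_left _ _))
    have hzP : z ∉ P := hb2 (by
      rw [mem_ball, dist_comm]; exact hbz.trans_le (min_le_right _ _))
    rw [isPreconnected_closed_iff] at hF
    obtain ⟨w, -, hwP, hwR⟩ := hF P R hP hR hsub ⟨y, hy, (hsub hy).resolve_right hyR⟩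
      ⟨z, hz, (hsub hz).resolve_left hzP⟩
    exact disjoint_left.1 hPR hwP hwR
  choose! δ hδ hδ' using key
  have hmin : ∃ d > 0, ∀ (a b : t) (p : N), a ≠ b → d ≤ δ a b p := by
    have hfin : (range fun q : t × t × N => if q.1 ≠ q.2.1 then δ q.1 q.2.1 q.2.2 else 1).Finite :=
      finite_range _
    obtain ⟨d, hd0, hd⟩ : ∃ d > 0, ∀ v ∈ range (fun q : t × t × N =>
        if q.1 ≠ q.2.1 then δ q.1 q.2.1 q.2.2 else 1), d ≤ v := by
      have hne : (insert (1:ℝ) (range fun q : t × t × N =>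
        if q.1 ≠ q.2.1 then δ q.1 q.2.1 q.2.2 else 1)).Nonempty := insert_nonempty _ _
      obtain ⟨d, hd, hdm⟩ := exists_min_image _ id (hfin.insert 1) hne
      refine ⟨d, ?_, fun v hv => hdm v (Or.inr hv)⟩
      rcases hd with rfl | ⟨q, rfl⟩
      · exact one_pos
      · dsimp only
        split_ifs with h
        · exact hδ _ _ _ h
        · exact one_pos
    refine ⟨d, hd0, fun a b p hab => ?_⟩
    have := hd _ ⟨(a, b, p), rfl⟩
    simpa [hab] using this
  obtain ⟨d, hd0, hd⟩ := hmin
  refine ⟨d, hd0, fun ι _ hcard F hF hFX hdense => ?_⟩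
  have : Nonempty ι := ⟨(hdense x0 hx0).choose⟩
  choose! g hg using hdense
  have hcard' : Fintype.card ι < Fintype.card t := by
    rw [Fintype.card_coe, htc]; omega
  obtain ⟨a, b, hab, hgab⟩ := Fintype.exists_ne_map_eq_of_card_lt (fun a : t => g (a : S)) hcard'
  have ha := hg a (hYX (htY a.2))
  have hb := hg b (hYX (htY b.2))
  have hgab' : g (b : S) = g (a : S) := hgab.symm
  rw [hgab'] at hb
  refine ⟨g a, ?_⟩
  have hmeet : ∀ p : N, ¬ Disjoint (F (g a)) (ball (p : S) (ε / 2)) := by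
    intro p hdis
    refine hδ' a b p hab (F (g a)) (hF _) (hFX _) hdis ?_ ?_
    · obtain ⟨y, hy, h⟩ := ha; exact ⟨y, hy, h.trans_le (hd a b p hab)⟩
    · obtain ⟨y, hy, h⟩ := hb; exact ⟨y, hy, h.trans_le (hd a b p hab)⟩
  intro x hx
  obtain ⟨p, hp, hxp⟩ := mem_iUnion₂.1 (hNc hx)
  obtain ⟨y, hy, hyp⟩ := not_disjoint_iff.1 (hmeet ⟨p, hp⟩)
  refine ⟨y, hy, ?_⟩
  have h1 := mem_ball.1 hxp
  have h2 := mem_ball.1 hyp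
  have := dist_triangle_right x y p
  simp only at h2
  linarith

end Indec


section ClaimOne

theorem dom_facts {S : Type*} [TopologicalSpace S] [LocallyConnectedSpace S] {X U : Set S}
    (hX : IsClosed X) (hU : IsComplementaryDomain X U) :
    IsOpen U ∧ IsConnected U ∧ frontier U ⊆ X ∧ Disjoint U X := by
  obtain ⟨x, hx, rfl⟩ := hU
  refine ⟨hX.isOpen_compl.connectedComponentIn, isConnected_connectedComponentIn_iff.2 hx, ?_, ?_⟩
  · have := frontier_comp_subset hX.isOpen_compl x
    rwa [compl_compl] at this
  · rw [disjoint_left]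
    exact fun z hz => connectedComponentIn_subset _ _ hz

theorem dom_eq {S : Type*} [TopologicalSpace S] {X U V : Set S}
    (hU : IsComplementaryDomain X U) (hV : IsComplementaryDomain X V) {z : S} (h1 : z ∈ U)
    (h2 : z ∈ V) : U = V := by
  obtain ⟨x, hx, rfl⟩ := hU
  obtain ⟨y, hy, rfl⟩ := hV
  rw [connectedComponentIn_eq h1, connectedComponentIn_eq h2]

theorem preconn_meets_frontier {S : Type*} [TopologicalSpace S] {B U : Set S} (hB : IsPreconnected B)
    (h1 : (B ∩ U).Nonempty) (h2 : (B ∩ Uᶜ).Nonempty) : (B ∩ frontier U).Nonempty := by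
  by_contra h
  have hd : ∀ z ∈ B, z ∉ frontier U := fun z hz hz' => h ⟨z, hz, hz'⟩
  obtain ⟨x, hxB, hxU⟩ := h1
  obtain ⟨y, hyB, hyU⟩ := h2
  obtain ⟨w, hw, hw1, hw2⟩ := hB (interior U) (closure U)ᶜ isOpen_interior
    isClosed_closure.isOpen_compl
    (fun z hz => by
      by_cases hzc : z ∈ closure U
      · left
        by_contra hzi
        exact hd z hz ⟨hzc, hzi⟩
      · exact Or.inr hzc)
    ⟨x, hxB, by
      by_contra hzi
      exact hd x hxB ⟨subset_closure hxU, hzi⟩⟩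
    ⟨y, hyB, fun hc => hd y hyB ⟨hc, fun hi => hyU (interior_subset hi)⟩⟩
  exact hw2 (subset_closure (interior_subset hw1))

theorem dom_ext_cont {S : Type*} [TopologicalSpace S] {U T : Set S} (hU : IsOpen U)
    (hT : IsClosed T) {β : Type*} [TopologicalSpace β] {f g : S → β} (hf : ContinuousOn f (closure U ∩ T))
    (hg : ContinuousOn g (T \ U)) (h : ∀ x ∈ frontier U ∩ T, f x = g x) :
    ∃ F : S → β, ContinuousOn F T ∧ (∀ x ∈ closure U ∩ T, F x = f x) ∧ ∀ x ∈ T \ U, F x = g x := by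
  obtain ⟨F, h1, h2, h3⟩ := glue_on (isClosed_closure.inter hT) (hT.sdiff hU) hf hg (by
    rintro x ⟨⟨hx, hxT⟩, -, hxU⟩
    exact h x ⟨by rw [hU.frontier_eq]; exact ⟨hx, hxU⟩, hxT⟩)
  refine ⟨F, h1.mono fun x hx => ?_, h2, h3⟩
  by_cases hxU : x ∈ U
  · exact Or.inl ⟨subset_closure hxU, hx⟩
  · exact Or.inr ⟨hx, hxU⟩

theorem cont_finite_closed {S β ι : Type*} [TopologicalSpace S] [TopologicalSpace β] (s : Finset ι)
    (A : ι → Set S) (hA : ∀ i ∈ s, IsClosed (A i)) {f : S → β}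
    (hf : ∀ i ∈ s, ContinuousOn f (A i)) : ContinuousOn f (⋃ i ∈ s, A i) := by
  classical
  induction s using Finset.induction_on with
  | empty => simp
  | insert a s ha ih =>
    rw [Finset.set_biUnion_insert]
    refine (hf a (by simp)).union_of_isClosed (ih (fun i hi => hA i (by simp [hi]))
      (fun i hi => hf i (by simp [hi]))) (hA a (by simp)) ?_
    exact s.finite_toSet.isClosed_biUnion (fun i hi => hA i (Finset.mem_insert_of_mem hi))

theorem domain_functions {S : Type*} [MetricSpace S] [LocallyConnectedSpace S] {X O P R N1 N0 : Set S}
    (hX : IsClosed X) (hO : IsOpen O) (hP : IsClosed P) (hR : IsClosed R) (hPR : P ∪ R = X \ O)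
    (hN1 : IsOpen N1) (hN0 : IsOpen N0) (hPN : P ⊆ N1) (hRN : R ⊆ N0) (hN : Disjoint N1 N0)
    (D : Finset (Set S)) (hD : ∀ U ∈ D, IsComplementaryDomain X U)
    (hcov : (O ∪ N1 ∪ N0)ᶜ ⊆ ⋃ U ∈ D, U) :
    ∃ (h : Set S → S → ℂ) (l : S → ℂ), (∀ U ∈ D, ContinuousOn (h U) Oᶜ) ∧ (∀ U x, h U x ≠ 0) ∧
      (∀ U x, x ∉ U → h U x = 1) ∧ ContinuousOn l Oᶜ ∧ (∀ x ∈ Oᶜ, ex (l x) = ∏ U ∈ D, h U x) ∧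
      (∀ x ∈ P, l x = 1) ∧ ∀ x ∈ R, l x = 0 := by
  classical
  have hdis : Disjoint R P := (hN.mono hPN hRN).symm
  have hPX : P ⊆ X \ O := by rw [← hPR]; exact subset_union_left
  have hRX : R ⊆ X \ O := by rw [← hPR]; exact subset_union_right
  obtain ⟨g, hg0, hg1, -⟩ := exists_continuous_zero_one_of_isClosed hR hP hdis
  let gc : S → ℂ := fun x => (g x : ℂ)
  have hgc : Continuous gc := Complex.continuous_ofReal.comp g.continuous
  have hgP : ∀ x ∈ P, gc x = 1 := fun x hx => by simp [gc, hg1 hx]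
  have hgR : ∀ x ∈ R, gc x = 0 := fun x hx => by simp [gc, hg0 hx]
  have hgT : ∀ x ∈ X \ O, ex (gc x) = 1 := by
    intro x hx
    rw [← hPR] at hx
    rcases hx with h | h
    · rw [hgP x h, ex_one]
    · rw [hgR x h, ex_zero]
  let h : Set S → S → ℂ := fun U x => if x ∈ U then ex (gc x) else 1
  let lam : S → ℂ := fun x => if x ∈ N1 then 1 else 0
  let l : S → ℂ := fun x => if x ∈ ⋃ U ∈ D, U then gc x else lam x
  have hDo : ∀ U ∈ D, IsOpen U := fun U hU => (dom_facts hX (hD U hU)).1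
  have hXD : ∀ x ∈ X, x ∉ ⋃ U ∈ D, U := by
    intro x hx hxU
    obtain ⟨U, hU, hxU⟩ := mem_iUnion₂.1 hxU
    exact disjoint_left.1 (dom_facts hX (hD U hU)).2.2.2 hxU hx
  have hlP : ∀ x ∈ P, l x = 1 := by
    intro x hx
    simp only [l, if_neg (hXD x (hPX hx).1), lam, if_pos (hPN hx)]
  have hlR : ∀ x ∈ R, l x = 0 := by
    intro x hx
    simp only [l, if_neg (hXD x (hRX hx).1), lam, if_neg (disjoint_right.1 hN (hRN hx))]
  have hlT : ∀ x ∈ X \ O, l x = gc x := by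
    intro x hx
    rw [← hPR] at hx
    rcases hx with h | h
    · rw [hgP x h, hlP x h]
    · rw [hgR x h, hlR x h]
  refine ⟨h, l, ?_, ?_, ?_, ?_, ?_, hlP, hlR⟩
  · intro U hU
    obtain ⟨F, hF1, hF2, hF3⟩ := dom_ext_cont (hDo U hU) hO.isClosed_compl
      (f := fun x => ex (gc x)) (g := fun _ => (1:ℂ))
      (ex_continuous.comp hgc).continuousOn continuousOn_const (by
        rintro x ⟨hx, hxO⟩
        exact hgT x ⟨(dom_facts hX (hD U hU)).2.2.1 hx, hxO⟩)
    refine hF1.congr fun x hx => ?_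
    by_cases hxU : x ∈ U
    · rw [hF2 x ⟨subset_closure hxU, hx⟩]; simp [h, hxU]
    · rw [hF3 x ⟨hx, hxU⟩]; simp [h, hxU]
  · intro U x
    simp only [h]
    split_ifs
    · exact ex_ne_zero _
    · exact one_ne_zero
  · intro U x hx
    simp [h, hx]
  · have hsub : Oᶜ ⊆ (⋃ U ∈ D, (closure U ∩ Oᶜ)) ∪ (Oᶜ \ ⋃ U ∈ D, U) := by
      intro x hx
      by_cases hxD : x ∈ ⋃ U ∈ D, U
      · left
        obtain ⟨U, hU, hxU⟩ := mem_iUnion₂.1 hxD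
        exact mem_iUnion₂.2 ⟨U, hU, subset_closure hxU, hx⟩
      · exact Or.inr ⟨hx, hxD⟩
    refine ContinuousOn.mono (ContinuousOn.union_of_isClosed ?_ ?_ ?_ ?_) hsub
    · refine cont_finite_closed D _ (fun U _ => isClosed_closure.inter hO.isClosed_compl) ?_
      intro U hU
      refine hgc.continuousOn.congr ?_
      rintro x ⟨hx, hxO⟩
      by_cases hxU : x ∈ U
      · simp only [l]
        rw [if_pos (mem_iUnion₂.2 ⟨U, hU, hxU⟩)]
      · apply hlT
        refine ⟨(dom_facts hX (hD U hU)).2.2.1 ?_, hxO⟩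
        rw [(hDo U hU).frontier_eq]
        exact ⟨hx, hxU⟩
    · have hsub2 : Oᶜ \ ⋃ U ∈ D, U ⊆ N1 ∪ N0 := by
        rintro x ⟨hx, hxD⟩
        by_contra hc
        apply hxD
        apply hcov
        rintro ((h | h) | h)
        · exact hx h
        · exact hc (Or.inl h)
        · exact hc (Or.inr h)
      have hlam : ContinuousOn lam (N1 ∪ N0) := by
        refine ContinuousOn.union_of_isOpen ?_ ?_ hN1 hN0
        · refine continuousOn_const (c := (1:ℂ)) |>.congr fun x hx => ?_
          simp [lam, hx]
        · refine continuousOn_const (c := (0:ℂ)) |>.congr fun x hx => ?_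
          simp [lam, disjoint_right.1 hN hx]
      refine (hlam.mono hsub2).congr fun x hx => ?_
      simp only [l]
      rw [if_neg hx.2]
    · exact D.finite_toSet.isClosed_biUnion fun U _ => isClosed_closure.inter hO.isClosed_compl
    · exact hO.isClosed_compl.sdiff (isOpen_biUnion hDo)
  · intro x hx
    by_cases hxD : x ∈ ⋃ U ∈ D, U
    · have hl : l x = gc x := by simp only [l]; rw [if_pos hxD]
      obtain ⟨U, hU, hxU⟩ := mem_iUnion₂.1 hxD
      rw [Finset.prod_eq_single U, hl]
      · simp [h, hxU]
      · intro V hV hne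
        have : x ∉ V := fun hxV => hne (dom_eq (hD V hV) (hD U hU) hxV hxU)
        simp [h, this]
      · exact fun hn => absurd hU hn
    · have hl : l x = lam x := by simp only [l]; rw [if_neg hxD]
      rw [hl, Finset.prod_eq_one]
      · simp only [lam]
        split_ifs
        · exact ex_one
        · exact ex_zero
      · intro U hU
        have : x ∉ U := fun hxU => hxD (mem_iUnion₂.2 ⟨U, hU, hxU⟩)
        simp [h, this]

end ClaimOne


theorem claim_one {S : Type*} [MetricSpace S] [CompactSpace S] (hS : LocallyEuclidean2 S)
    {X : Set S} (hX : IsContinuum X) (hind : ¬ IsDecomposable X) (hnt : X.Nontrivial) {ε : ℝ}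
    (hε : 0 < ε) :
    ∃ U, IsComplementaryDomain X U ∧ ∀ x ∈ X, ∃ y ∈ frontier U, dist x y < ε := by
  classical
  have := locConn hS
  by_contra hcon
  push Not at hcon
  -- a finite net
  obtain ⟨Nt, hNX, hNf, hNc⟩ := hX.1.finite_cover_balls (half_pos hε)
  have : Finite Nt := hNf
  obtain ⟨k, ⟨e⟩⟩ := Finite.exists_equiv_fin Nt
  let p : Fin k → S := fun i => (e.symm i : S)
  have hpX : ∀ i, p i ∈ X := fun i => hNX (e.symm i).2
  have hkpos : Nonempty (Fin k) := by
    obtain ⟨x, hx⟩ := hX.2.nonempty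
    obtain ⟨q, hq, -⟩ := mem_iUnion₂.1 (hNc hx)
    exact ⟨e ⟨q, hq⟩⟩
  have hsel : ∀ U, IsComplementaryDomain X U → ∃ i : Fin k,
      ∀ y ∈ frontier U, y ∉ ball (p i) (ε / 2) := by
    intro U hU
    obtain ⟨x, hx, hxU⟩ := hcon U hU
    obtain ⟨q, hq, hxq⟩ := mem_iUnion₂.1 (hNc hx)
    refine ⟨e ⟨q, hq⟩, fun y hy hyb => ?_⟩
    have h1 := hxU y hy
    simp only [p, Equiv.symm_apply_apply, mem_ball] at hyb
    rw [mem_ball] at hxq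
    have := dist_triangle_right x y q
    linarith
  choose! ix hix using hsel
  -- the base point
  obtain ⟨x0, hx0, hx0r⟩ := avoid_classes hX hind (countable_range p)
    (range_subset_iff.2 hpX)
  have hx0p : ∀ i, p i ≠ x0 := by
    intro i h
    apply hx0r (p i) (mem_range_self i)
    rw [h]
    exact CRel.refl hnt hx0
  let r : Fin k → ℝ := fun i => min (ε / 2) (dist (p i) x0 / 2)
  have hrpos : ∀ i, 0 < r i := fun i =>
    lt_min (half_pos hε) (half_pos (dist_pos.2 (hx0p i)))
  let B : Fin k → Set S := fun i => connectedComponentIn (ball (p i) (r i)) (p i)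
  have hBo : ∀ i, IsOpen (B i) := fun i => isOpen_ball.connectedComponentIn
  have hpB : ∀ i, p i ∈ B i := fun i => mem_connectedComponentIn (mem_ball_self (hrpos i))
  have hBb : ∀ i, B i ⊆ ball (p i) (r i) := fun i => connectedComponentIn_subset _ _
  have hBp : ∀ i, IsPreconnected (B i) := fun i => isPreconnected_connectedComponentIn
  have hcl : IsClosed (⋃ i, closedBall (p i) (r i)) :=
    isClosed_iUnion_of_finite fun i => isClosed_closedBall
  have hx0cl : x0 ∉ ⋃ i, closedBall (p i) (r i) := by
    intro h
    obtain ⟨i, hi⟩ := mem_iUnion.1 h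
    rw [mem_closedBall, dist_comm] at hi
    have h1 : r i ≤ dist (p i) x0 / 2 := min_le_right _ _
    have h2 := dist_pos.2 (hx0p i)
    linarith
  obtain ⟨ρ0, hρ0, hρ0b⟩ := Metric.isOpen_iff.1 hcl.isOpen_compl x0 hx0cl
  obtain ⟨ρ, hρ, hρρ0, Y, hYi, hYX, hYp, hYC⟩ := INF hX hind hnt hx0 B hBo
    (fun i => ⟨p i, hpX i, hpB i⟩) hρ0
  choose! C hyC hCp hCX hCB using hYC
  have hBO : ∀ i, B i ⊆ (ball x0 ρ)ᶜ := by
    intro i z hz hzb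
    refine hρ0b (ball_subset_ball hρρ0.le hzb) (mem_iUnion.2 ⟨i, ?_⟩)
    exact ball_subset_closedBall (hBb i hz)
  set O := ball x0 (ρ / 2) with hO
  have hOo : IsOpen O := isOpen_ball
  set Q := (ball x0 ρ)ᶜ with hQ
  have hQc : IsCompact Q := isOpen_ball.isClosed_compl.isCompact
  have hQO : Q ⊆ Oᶜ := compl_subset_compl.2 (ball_subset_ball (by linarith))
  have hGO : (closedBall x0 (ρ / 2))ᶜ ⊆ Oᶜ := compl_subset_compl.2 ball_subset_closedBall
  obtain ⟨N, hN⟩ := rank_lemma hS hQc (G := (closedBall x0 (ρ / 2))ᶜ)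
    isClosed_closedBall.isOpen_compl (compl_subset_compl.2 (closedBall_subset_ball (by linarith)))
  set m := k * N + 1 with hm
  let c : ℕ → S := fun l => (hYi.natEmbedding Y l : S)
  have hcY : ∀ l, c l ∈ Y := fun l => (hYi.natEmbedding Y l).2
  have hcinj : Function.Injective c := Subtype.val_injective.comp (hYi.natEmbedding Y).injective
  have hcX : ∀ l, c l ∈ X := fun l => hYX (hcY l)
  have hcQ : ∀ l, c l ∈ Q := fun l => (hCX _ (hcY l) (hyC _ (hcY l))).2
  have hcO : ∀ l, c l ∉ O := fun l => hQO (hcQ l)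
  have hOX : (X ∩ O).Nonempty := ⟨x0, hx0, mem_ball_self (half_pos hρ)⟩
  -- separations
  have hsep : ∀ j : Fin m, ∃ P R N1 N0 : Set S, IsClosed P ∧ IsClosed R ∧ P ∪ R = X \ O ∧
      IsOpen N1 ∧ IsOpen N0 ∧ P ⊆ N1 ∧ R ⊆ N0 ∧ Disjoint N1 N0 ∧ c (j + 1) ∈ P ∧
      ∀ l ≤ m, l ≠ j + 1 → c l ∈ R := by
    intro j
    have hBf : (c '' {l | l ≤ m ∧ l ≠ j + 1}).Finite :=
      ((finite_Iic m).subset fun l hl => hl.1).image c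
    obtain ⟨P, R, h1, h2, h3, h4, h5, h6⟩ := clopen_sep_in (hX.1.diff hOo) hBf.isClosed
      (x := c (j + 1)) ⟨hcX _, hcO _⟩ (by
        rw [disjoint_right]
        rintro _ ⟨l, ⟨-, hl⟩, rfl⟩ hmem
        exact hYp (hcY (j + 1)) (hcY l) (fun h => hl (hcinj h).symm)
          ⟨_, comp_proper hX hOo hOX (hcX _) (hcO _),
            mem_connectedComponentIn ⟨hcX _, hcO _⟩, hmem⟩)
    obtain ⟨N1, N0, g1, g2, g3, g4, g5⟩ := normal_separation h1 h2 h3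
    refine ⟨P, R, N1, N0, h1, h2, h4, g1, g2, g3, g4, g5, h5, fun l hl hne => ?_⟩
    have : c l ∈ P ∪ R := by rw [h4]; exact ⟨hcX _, hcO _⟩
    exact this.resolve_left fun h => disjoint_left.1 h6 h ⟨l, ⟨hl, hne⟩, rfl⟩
  choose P R N1 N0 hP hR hPR hN1 hN0 hPN hRN hNN hcP hcR using hsep
  -- finitely many domains
  have hMc : IsCompact (⋃ j, (O ∪ N1 j ∪ N0 j)ᶜ) :=
    (isClosed_iUnion_of_finite fun j =>
      ((hOo.union (hN1 j)).union (hN0 j)).isClosed_compl).isCompact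
  have hMX : ∀ z ∈ ⋃ j, (O ∪ N1 j ∪ N0 j)ᶜ, z ∉ X := by
    intro z hz hzX
    obtain ⟨j, hj⟩ := mem_iUnion.1 hz
    by_cases hzO : z ∈ O
    · exact hj (Or.inl (Or.inl hzO))
    · have : z ∈ P j ∪ R j := by rw [hPR]; exact ⟨hzX, hzO⟩
      rcases this with h | h
      · exact hj (Or.inl (Or.inr (hPN j h)))
      · exact hj (Or.inr (hRN j h))
  have hXc := hX.1.isClosed
  obtain ⟨t, ht, htc⟩ := hMc.elim_nhds_subcover (fun z => connectedComponentIn Xᶜ z) (fun z hz =>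
    hXc.isOpen_compl.connectedComponentIn.mem_nhds (mem_connectedComponentIn (hMX z hz)))
  let D : Finset (Set S) := t.image fun z => connectedComponentIn Xᶜ z
  have hD : ∀ U ∈ D, IsComplementaryDomain X U := by
    intro U hU
    obtain ⟨z, hz, rfl⟩ := Finset.mem_image.1 hU
    exact ⟨z, hMX z (ht z hz), rfl⟩
  have hDcov : ∀ j, (O ∪ N1 j ∪ N0 j)ᶜ ⊆ ⋃ U ∈ D, U := by
    intro j z hz
    obtain ⟨w, hw, hzw⟩ := mem_iUnion₂.1 (htc (mem_iUnion.2 ⟨j, hz⟩))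
    exact mem_iUnion₂.2 ⟨_, Finset.mem_image_of_mem _ hw, hzw⟩
  have hdf := fun j => domain_functions hXc hOo (hP j) (hR j) (hPR j) (hN1 j) (hN0 j) (hPN j)
    (hRN j) (hNN j) D hD (hDcov j)
  choose h l hh1 hh2 hh3 hl1 hl2 hlP hlR using hdf
  obtain ⟨n, hn0, hn⟩ := hN (Fin m) (Fin k) (by simp [hm])
    (fun j i x => ∏ U ∈ D with ix U = i, h j U x)
    (fun j i => continuousOn_finsetProd _ fun U hU =>
      (hh1 j U (Finset.mem_filter.1 hU).1).mono hGO)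
    (fun j i x _ => Finset.prod_ne_zero_iff.2 fun U _ => hh2 j U x)
  choose φ hφ hφ' using hn
  -- connected sets
  let E : Fin k → Set S := fun i => B i ∪ ⋃ l, C (c l)
  have hEQ : ∀ i, E i ⊆ Q := by
    rintro i z (hz | hz)
    · exact hBO i hz
    · obtain ⟨l, hl⟩ := mem_iUnion.1 hz
      exact (hCX _ (hcY l) hl).2
  have hcE : ∀ i l, c l ∈ E i := fun i l => Or.inr (mem_iUnion.2 ⟨l, hyC _ (hcY l)⟩)
  have hEp : ∀ i, IsPreconnected (E i) := by
    intro i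
    have e1 : E i = ⋃ l, (B i ∪ C (c l)) := by rw [← union_iUnion]
    rw [e1]
    refine isPreconnected_iUnion ⟨p i, mem_iInter.2 fun l => Or.inl (hpB i)⟩ fun l => ?_
    obtain ⟨z, hz1, hz2⟩ := hCB _ (hcY l) i
    exact (hBp i).union z hz2 hz1 (hCp _ (hcY l))
  have hφc : ∀ i l, φ i (c l) = φ i (c 0) := by
    intro i l
    refine ex_const (hEp i) ((hφ i).mono (hEQ i)) ?_ (hcE i l) (hcE i 0)
    intro x hx
    rw [hφ' i x (hEQ i hx)]
    refine Finset.prod_eq_one fun j _ => ?_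
    rw [Finset.prod_eq_one, one_zpow]
    intro U hU
    obtain ⟨hUD, hUi⟩ := Finset.mem_filter.1 hU
    apply hh3
    intro hxU
    rcases hx with hxB | hxC
    · obtain ⟨w, hwB, hwf⟩ := preconn_meets_frontier (hBp i) ⟨x, hxB, hxU⟩
        ⟨p i, hpB i, fun hpU =>
          disjoint_left.1 (dom_facts hXc (hD U hUD)).2.2.2 hpU (hpX i)⟩
      have h1 := hix U (hD U hUD) w hwf
      rw [hUi] at h1
      exact h1 (ball_subset_ball (min_le_left _ _) (hBb i hwB))
    · obtain ⟨l', hl'⟩ := mem_iUnion.1 hxC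
      exact disjoint_left.1 (dom_facts hXc (hD U hUD)).2.2.2 hxU (hCX _ (hcY l') hl').1
  have hψ : ∀ q, ∑ j, (n j : ℂ) * l j (c q) = ∑ j, (n j : ℂ) * l j (c 0) := by
    intro q
    obtain ⟨i0⟩ := hkpos
    have h1 : ∑ j, (n j : ℂ) * l j (c q) - ∑ i, φ i (c q) =
        ∑ j, (n j : ℂ) * l j (c 0) - ∑ i, φ i (c 0) := by
      refine ex_const (φ := fun x => ∑ j, (n j : ℂ) * l j x - ∑ i, φ i x) (hEp i0) ?_ ?_
        (hcE i0 q) (hcE i0 0)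
      · refine ContinuousOn.sub ?_ ?_
        · exact continuousOn_finsetSum _ fun j _ => continuousOn_const.mul
            ((hl1 j).mono ((hEQ i0).trans hQO))
        · exact continuousOn_finsetSum _ fun i _ => (hφ i).mono (hEQ i0)
      · intro x hx
        have hxQ := hEQ i0 hx
        rw [ex_sub, ex_sum, ex_sum]
        have e1 : ∀ j, ex ((n j : ℂ) * l j x) = (∏ U ∈ D, h j U x) ^ n j := by
          intro j
          rw [ex_int_mul, hl2 j x (hQO hxQ)]
        have e2 : ∏ i, ex (φ i x) = ∏ j, (∏ U ∈ D, h j U x) ^ n j := by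
          rw [Finset.prod_congr rfl fun i _ => hφ' i x hxQ, Finset.prod_comm]
          refine Finset.prod_congr rfl fun j _ => ?_
          rw [Finset.prod_zpow, Finset.prod_fiberwise_of_maps_to (fun _ _ => Finset.mem_univ _)]
        rw [e2, Finset.prod_congr rfl fun j _ => e1 j, div_self]
        exact Finset.prod_ne_zero_iff.2 fun j _ => zpow_ne_zero _
          (Finset.prod_ne_zero_iff.2 fun U _ => hh2 j U x)
    rw [Finset.sum_congr rfl fun i _ => hφc i q] at h1
    exact sub_left_injective h1
  apply hn0
  funext j
  have h1 := hψ (j + 1)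
  have e0 : ∑ j, (n j : ℂ) * l j (c 0) = 0 :=
    Finset.sum_eq_zero fun j _ => by rw [hlR j _ (hcR j 0 (Nat.zero_le _) (by omega)), mul_zero]
  rw [e0, Finset.sum_eq_single j] at h1
  · rw [hlP j _ (hcP j), mul_one] at h1
    exact_mod_cast h1
  · intro j' _ hne
    rw [hlR j' _ (hcR j' (j + 1) (by have := j.2; omega) (fun hh => hne (Fin.ext (by omega)))),
      mul_zero]
  · exact fun hj => absurd (Finset.mem_univ _) hj


section Crosscut

theorem chartIn {S : Type*} [TopologicalSpace S] (hS : LocallyEuclidean2 S) {G : Set S}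
    (hG : IsOpen G) {x : S} (hx : x ∈ G) :
    ∃ (e : ℂ → S) (z : ℂ), IsOpenEmbedding e ∧ e z = x ∧ range e ⊆ G := by
  obtain ⟨e, he, z, rfl⟩ := chartC hS x
  obtain ⟨r, hr, hb⟩ := Metric.isOpen_iff.1 (hG.preimage he.continuous) z hx
  let u := OpenPartialHomeomorph.univBall z r
  have hu : IsOpenEmbedding u := u.isOpenEmbedding (OpenPartialHomeomorph.univBall_source z r)
  refine ⟨fun w => e (u w), 0, he.comp hu, ?_, ?_⟩
  · simp [u, OpenPartialHomeomorph.univBall_apply_zero]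
  · rintro _ ⟨w, rfl⟩
    apply hb
    rw [← OpenPartialHomeomorph.univBall_target z hr]
    exact u.map_source (by simp [u])

theorem param {S : Type*} [TopologicalSpace S] {U K : Set S} (h : IsGenCrosscut U K) :
    ∃ γ : ℝ → S, IsEmbedding γ ∧ range γ = K := by
  obtain ⟨-, ⟨k⟩, -⟩ := h
  let u : ℝ → Ioo (0:ℝ) 1 := fun t => ⟨Real.sigmoid t, Real.sigmoid_pos t, Real.sigmoid_lt_one t⟩
  have hs : IsEmbedding Real.sigmoid := IsEmbedding.subtypeVal.comp Topology.isEmbedding_sigmoid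
  have hu : IsEmbedding u := hs.codRestrict (Ioo (0:ℝ) 1)
    (fun t => ⟨Real.sigmoid_pos t, Real.sigmoid_lt_one t⟩)
  have hus : Function.Surjective u := by
    rintro ⟨y, hy⟩
    rw [← Real.range_sigmoid] at hy
    obtain ⟨t, ht⟩ := hy
    exact ⟨t, Subtype.ext ht⟩
  refine ⟨fun t => (k.symm (u t) : S), IsEmbedding.subtypeVal.comp (k.symm.isEmbedding.comp hu), ?_⟩
  ext x
  constructor
  · rintro ⟨t, rfl⟩
    exact (k.symm (u t)).2
  · intro hx
    obtain ⟨t, ht⟩ := hus (k ⟨x, hx⟩)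
    exact ⟨t, by simp [ht]⟩

theorem embed_empty_interior {S : Type*} [TopologicalSpace S] (hS : LocallyEuclidean2 S)
    {γ : ℝ → S} (hγ : IsEmbedding γ) : interior (range γ) = ∅ := by
  by_contra hne
  obtain ⟨x, hx⟩ := nonempty_iff_ne_empty.2 hne
  obtain ⟨e, -, he, -, hr⟩ := chartIn hS isOpen_interior hx
  have hr' : ∀ z, ∃ t, γ t = e z := fun z =>
    mem_range.1 (interior_subset (hr (mem_range_self z)))
  choose f hf using hr'
  have hfc : Continuous f := by
    rw [hγ.isInducing.continuous_iff]
    have : γ ∘ f = e := funext hf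
    rw [this]
    exact he.continuous
  have hfi : Function.Injective f := fun a b hab => he.injective (by rw [← hf, ← hf, hab])
  have key : ∀ x y z, f x < f y → f y < f z → False := by
    intro x y z h1 h2
    have hc : IsPreconnected ({y}ᶜ : Set ℂ) :=
      (isConnected_compl_singleton_of_one_lt_rank (by
        rw [Complex.rank_real_complex]; norm_num) y).isPreconnected
    have := (hc.image f hfc.continuousOn).Icc_subset
      (mem_image_of_mem f (show x ∈ ({y}ᶜ : Set ℂ) from fun h => by
        rw [mem_singleton_iff.1 h] at h1; exact lt_irrefl _ h1))
      (mem_image_of_mem f (show z ∈ ({y}ᶜ : Set ℂ) from fun h => by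
        rw [mem_singleton_iff.1 h] at h2; exact lt_irrefl _ h2))
    obtain ⟨w, hw, hwy⟩ := this ⟨h1.le, h2.le⟩
    exact hw (hfi hwy)
  have n1 : f 0 ≠ f 1 := fun h => by simpa using hfi h
  have n2 : f 0 ≠ f 2 := fun h => by simpa using hfi h
  have n3 : f 1 ≠ f 2 := fun h => by simpa using hfi h
  rcases lt_or_gt_of_ne n1 with h1 | h1 <;> rcases lt_or_gt_of_ne n2 with h2 | h2 <;>
    rcases lt_or_gt_of_ne n3 with h3 | h3
  all_goals first
    | exact key _ _ _ h1 h2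
    | exact key _ _ _ h1 h3
    | exact key _ _ _ h2 h1
    | exact key _ _ _ h2 h3
    | exact key _ _ _ h3 h1
    | exact key _ _ _ h3 h2

theorem pre_closed {S : Type*} [TopologicalSpace S] {U : Set S} {γ : ℝ → S} (hγ : IsEmbedding γ)
    (hcl : closure (range γ) ∩ U ⊆ range γ) {e : ℂ → S} (he : Continuous e) (hr : range e ⊆ U)
    {A : Set ℝ} (hA : IsClosed A) : IsClosed (e ⁻¹' (γ '' A)) := by
  obtain ⟨C, hC, rfl⟩ := hγ.isInducing.isClosed_iff.1 hA
  have : e ⁻¹' (γ '' (γ ⁻¹' C)) = e ⁻¹' (closure (range γ) ∩ C) := by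
    rw [image_preimage_eq_inter_range]
    ext z
    constructor
    · rintro ⟨h1, h2⟩
      exact ⟨subset_closure h2, h1⟩
    · rintro ⟨h1, h2⟩
      exact ⟨h2, hcl ⟨h1, hr (mem_range_self z)⟩⟩
  rw [this]
  exact (isClosed_closure.inter hC).preimage he

theorem pre_arc {S : Type*} [TopologicalSpace S] {γ : ℝ → S} (hγ : IsEmbedding γ)
    {e : ℂ → S} (he : IsOpenEmbedding e) {a b : ℝ} (hab : a ≤ b)
    (h : ∀ s ∈ Icc a b, γ s ∈ range e) :
    IsCompact (e ⁻¹' (γ '' Icc a b)) ∧ HasLogs (e ⁻¹' (γ '' Icc a b)) := by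
  have h' : ∀ s : Icc a b, ∃ z, e z = γ s := fun s => h s s.2
  choose β hβ using h'
  have hβc : Continuous β := by
    rw [he.isInducing.continuous_iff]
    have : e ∘ β = fun s : Icc a b => γ s := funext hβ
    rw [this]
    exact hγ.continuous.comp continuous_subtype_val
  have hβi : Function.Injective β := fun s t hst =>
    Subtype.ext (hγ.injective (by rw [← hβ, ← hβ, hst]))
  have hrange : e ⁻¹' (γ '' Icc a b) = range β := by
    ext z
    constructor
    · rintro ⟨s, hs, hsz⟩
      exact ⟨⟨s, hs⟩, he.injective (by rw [hβ, hsz])⟩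
    · rintro ⟨s, rfl⟩
      exact ⟨s, s.2, (hβ s).symm⟩
  rw [hrange]
  exact ⟨isCompact_range hβc, hasLogs_arc hab β hβc hβi⟩

/-- a ball in the chart avoiding a given part of the arc -/
theorem pre_ball {S : Type*} [TopologicalSpace S] {γ : ℝ → S} (hγ : IsEmbedding γ)
    {e : ℂ → S} {A : Set ℝ} (hA : IsClosed (e ⁻¹' (γ '' A))) {z : ℂ} {t : ℝ} (hz : e z = γ t)
    (ht : t ∉ A) : ∃ ρ > 0, Disjoint (ball z ρ) (e ⁻¹' (γ '' A)) := by
  have hzn : z ∈ (e ⁻¹' (γ '' A))ᶜ := by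
    rintro ⟨s, hs, hsz⟩
    rw [hz] at hsz
    exact ht (hγ.injective hsz ▸ hs)
  obtain ⟨ρ, hρ, hb⟩ := Metric.isOpen_iff.1 hA.isOpen_compl z hzn
  exact ⟨ρ, hρ, disjoint_left.2 fun w hw => hb hw⟩

theorem theta_step {S : Type*} [TopologicalSpace S] [LocallyConnectedSpace S]
    (hS : LocallyEuclidean2 S) {U : Set S} (hU : IsOpen U) {γ : ℝ → S} (hγ : IsEmbedding γ)
    (hcl : closure (range γ) ∩ U ⊆ range γ) {V : Set S} (hVU : V ⊆ U \ range γ)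
    (hfr : frontier V ⊆ (U \ range γ)ᶜ) {e : ℂ → S} (he : IsOpenEmbedding e) (hr : range e ⊆ U)
    {a t s1 s2 : ℝ} (hat : a < t) (hts : t < s1) (hss : s1 < s2)
    (harc : ∀ s ∈ Icc a s1, γ s ∈ range e) (ht : γ t ∈ closure V)
    (hs : ∀ s ∈ Icc s1 s2, γ s ∉ closure V) : ∀ᶠ s in 𝓝 t, γ s ∈ closure V := by
  obtain ⟨hJc, hJl⟩ := pre_arc hγ he (hat.trans hts).le harc
  have hFc : IsClosed (e ⁻¹' (γ '' (Iic a ∪ Ici s2))) :=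
    pre_closed hγ hcl he.continuous hr (isClosed_Iic.union isClosed_Ici)
  obtain ⟨z, hz⟩ := harc t ⟨hat.le, hts.le⟩
  obtain ⟨ρ, hρ, hdis⟩ := pre_ball hγ hFc hz (by
    rintro (h | h)
    · exact absurd (mem_Iic.1 h) (not_le.2 hat)
    · exact absurd (mem_Ici.1 h) (not_le.2 (hts.trans hss)))
  obtain ⟨c, hc⟩ := harc a ⟨le_rfl, (hat.trans hts).le⟩
  have hFJ : e ⁻¹' (γ '' (Iic a ∪ Ici s2)) ∩ e ⁻¹' (γ '' Icc a s1) ⊆ {c} := by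
    rintro w ⟨⟨s, hs1, hs2⟩, s', hs1', hs2'⟩
    have hss' : s = s' := hγ.injective (hs2.trans hs2'.symm)
    subst hss'
    rcases hs1 with h | h
    · have : s = a := le_antisymm h hs1'.1
      subst this
      exact he.injective (by rw [hc, hs2])
    · exact absurd (mem_Ici.1 h) (not_le.2 (hs1'.2.trans_lt hss))
  have hBo : IsOpen (e '' ball z ρ) := he.isOpenMap _ isOpen_ball
  have htB : γ t ∈ e '' ball z ρ := ⟨z, mem_ball_self hρ, hz⟩
  obtain ⟨_, ⟨q, hq, rfl⟩, hqV⟩ := mem_closure_iff.1 ht _ hBo htB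
  have hBV : e '' ball z ρ \ range γ ⊆ V := by
    rintro _ ⟨⟨q', hq', rfl⟩, hq'K⟩
    have hmem := PL1 hFc hJc hdis hJl c hFJ hq hq'
      (fun h => (hVU hqV).2 (image_subset_range _ _ h)) (fun h => hq'K (image_subset_range _ _ h))
    set C := connectedComponentIn (e ⁻¹' (γ '' (Iic a ∪ Ici s2)) ∪ e ⁻¹' (γ '' Icc a s1))ᶜ q with hC
    have hqC : q ∈ C := by
      refine mem_connectedComponentIn ?_
      rintro (h | h)
      · exact (hVU hqV).2 (image_subset_range _ _ h)
      · exact (hVU hqV).2 (image_subset_range _ _ h)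
    have hCp : IsPreconnected (e '' C) :=
      isPreconnected_connectedComponentIn.image e he.continuous.continuousOn
    by_contra hcon
    obtain ⟨_, ⟨w, hw, rfl⟩, hwf⟩ := preconn_meets_frontier hCp ⟨_, mem_image_of_mem e hqC, hqV⟩
      ⟨_, mem_image_of_mem e hmem, hcon⟩
    apply hfr hwf
    refine ⟨hr (mem_range_self _), ?_⟩
    rintro ⟨s, hsw⟩
    have hwn := connectedComponentIn_subset _ _ hw
    have hnot : ¬ (s ∈ Icc s1 s2) := fun h => hs s h (hsw ▸ hwf.1)
    apply hwn
    by_cases h1 : s ≤ a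
    · exact Or.inl ⟨s, Or.inl h1, hsw⟩
    by_cases h2 : s ≤ s1
    · exact Or.inr ⟨s, ⟨(not_le.1 h1).le, h2⟩, hsw⟩
    · refine Or.inl ⟨s, Or.inr ?_, hsw⟩
      by_contra h3
      exact hnot ⟨(not_le.1 h2).le, (not_le.1 h3).le⟩
  have hBcl : e '' ball z ρ ⊆ closure V := by
    intro x hx
    rw [_root_.mem_closure_iff]
    intro o ho hxo
    have hne : ¬ (o ∩ e '' ball z ρ ⊆ range γ) := by
      intro hsub
      have : x ∈ interior (range γ) := mem_interior.2 ⟨_, hsub, ho.inter hBo, hxo, hx⟩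
      rw [embed_empty_interior hS hγ] at this
      exact this
    obtain ⟨y, ⟨hyo, hyB⟩, hyK⟩ := not_subset.1 hne
    exact ⟨y, hyo, hBV ⟨hyB, hyK⟩⟩
  filter_upwards [(hBo.preimage hγ.continuous).mem_nhds htB] with s hs
  exact hBcl hs

theorem theta_open {S : Type*} [TopologicalSpace S] [LocallyConnectedSpace S]
    (hS : LocallyEuclidean2 S) {U : Set S} (hU : IsOpen U) {γ : ℝ → S} (hγ : IsEmbedding γ)
    (hγU : range γ ⊆ U)
    (hcl : closure (range γ) ∩ U ⊆ range γ) {V : Set S} (hVU : V ⊆ U \ range γ)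
    (hfr : frontier V ⊆ (U \ range γ)ᶜ) {t : ℝ} (ht : γ t ∈ closure V) :
    ∀ᶠ s in 𝓝 t, γ s ∈ closure V := by
  obtain ⟨e, z, he, hz, hr⟩ := chartIn hS hU (hγU (mem_range_self t))
  have hnb : γ ⁻¹' range e ∈ 𝓝 t :=
    (he.isOpen_range.preimage hγ.continuous).mem_nhds ⟨z, hz⟩
  obtain ⟨ε, hε, hb⟩ := Metric.mem_nhds_iff.1 hnb
  have hb' : ∀ s, |s - t| < ε → γ s ∈ range e := fun s hs => hb (by
    rw [mem_ball, Real.dist_eq]; exact hs)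
  by_cases hall : ∀ s ∈ ball t ε, γ s ∈ closure V
  · filter_upwards [ball_mem_nhds t hε] with s hs using hall s hs
  push Not at hall
  obtain ⟨s, hsb, hs⟩ := hall
  rw [mem_ball, Real.dist_eq] at hsb
  have hopen : IsOpen (γ ⁻¹' closure V)ᶜ := (isClosed_closure.preimage hγ.continuous).isOpen_compl
  obtain ⟨η, hη, hηb⟩ := Metric.isOpen_iff.1 hopen s hs
  have hηb' : ∀ u, |u - s| < η → γ u ∉ closure V := fun u hu => hηb (by
    rw [mem_ball, Real.dist_eq]; exact hu)
  have hst : η ≤ |t - s| := by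
    by_contra h
    exact hηb' t (not_le.1 h) ht
  rcases lt_or_ge t s with hlt | hge
  · rw [abs_of_neg (by linarith)] at hst
    rw [abs_of_pos (by linarith)] at hsb
    refine theta_step hS hU hγ hcl hVU hfr he hr (a := t - ε / 2) (s1 := s - η / 2) (s2 := s)
      (by linarith) (by linarith) (by linarith) ?_ ht ?_
    · rintro u ⟨h1, h2⟩
      exact hb' u (abs_lt.2 ⟨by linarith, by linarith⟩)
    · rintro u ⟨h1, h2⟩
      exact hηb' u (abs_lt.2 ⟨by linarith, by linarith⟩)
  · rw [abs_of_nonneg (by linarith)] at hst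
    rw [abs_of_nonpos (by linarith)] at hsb
    let γ' : ℝ → S := fun s => γ (-s)
    have hγ' : IsEmbedding γ' := hγ.comp (Homeomorph.neg ℝ).isEmbedding
    have hrg : range γ' = range γ := (Homeomorph.neg ℝ).surjective.range_comp γ
    have := theta_step (V := V) hS hU hγ' (by rwa [hrg]) (by rwa [hrg]) (by rwa [hrg]) he hr
      (a := - t - ε / 2) (t := -t) (s1 := - s - η / 2) (s2 := - s)
      (by linarith) (by linarith) (by linarith) (by
        rintro u ⟨h1, h2⟩
        exact hb' (-u) (abs_lt.2 ⟨by linarith, by linarith⟩)) (by simpa [γ'] using ht) (by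
        rintro u ⟨h1, h2⟩
        exact hηb' (-u) (abs_lt.2 ⟨by linarith, by linarith⟩))
    have h2 : Tendsto (fun s : ℝ => -s) (𝓝 t) (𝓝 (-t)) := continuous_neg.tendsto t
    filter_upwards [h2.eventually this] with u hu
    simpa [γ'] using hu

/-- every component of `U \ K` has all of `K` in its closure -/
theorem cross_b {S : Type*} [TopologicalSpace S] [LocallyConnectedSpace S] [T2Space S]
    (hS : LocallyEuclidean2 S) {U : Set S} (hU : IsOpen U) (hUc : IsPreconnected U) {γ : ℝ → S}
    (hγ : IsEmbedding γ) (hγU : range γ ⊆ U)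
    (hcl : closure (range γ) ∩ U ⊆ range γ) (hop : IsOpen (U \ range γ)) {x : S}
    (hx : x ∈ U \ range γ) : range γ ⊆ closure (connectedComponentIn (U \ range γ) x) := by
  set V := connectedComponentIn (U \ range γ) x with hV
  have hVU : V ⊆ U \ range γ := connectedComponentIn_subset _ _
  have hfr : frontier V ⊆ (U \ range γ)ᶜ := frontier_comp_subset hop x
  have hne : ∃ t, γ t ∈ closure V := by
    obtain ⟨y, hyU, hyf⟩ := preconn_meets_frontier hUc ⟨x, hx.1, mem_connectedComponentIn hx⟩
      ⟨γ 0, hγU (mem_range_self 0), fun h => (hVU h).2 (mem_range_self 0)⟩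
    have : y ∈ range γ := by
      by_contra h
      exact hfr hyf ⟨hyU, h⟩
    obtain ⟨t, rfl⟩ := this
    exact ⟨t, hyf.1⟩
  have hclopen : IsClopen (γ ⁻¹' closure V) :=
    ⟨isClosed_closure.preimage hγ.continuous, isOpen_iff_mem_nhds.2 fun t ht =>
      theta_open hS hU hγ hγU hcl hVU hfr ht⟩
  have := hclopen.eq_univ hne
  rintro _ ⟨t, rfl⟩
  have ht : t ∈ γ ⁻¹' closure V := by rw [this]; trivial
  exact ht

/-- `U \ K` has at most two components -/
theorem cross_a {S : Type*} [TopologicalSpace S] [LocallyConnectedSpace S] [T2Space S]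
    (hS : LocallyEuclidean2 S) {U : Set S} (hU : IsOpen U) (hUc : IsPreconnected U) {γ : ℝ → S}
    (hγ : IsEmbedding γ) (hγU : range γ ⊆ U)
    (hcl : closure (range γ) ∩ U ⊆ range γ) (hop : IsOpen (U \ range γ)) {x1 x2 x3 : S}
    (hx1 : x1 ∈ U \ range γ) (hx2 : x2 ∈ U \ range γ) (hx3 : x3 ∈ U \ range γ) :
    x2 ∈ connectedComponentIn (U \ range γ) x1 ∨ x3 ∈ connectedComponentIn (U \ range γ) x1 ∨
    x3 ∈ connectedComponentIn (U \ range γ) x2 := by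
  obtain ⟨e, z, he, hz, hr⟩ := chartIn hS hU (hγU (mem_range_self 0))
  have hnb : γ ⁻¹' range e ∈ 𝓝 0 :=
    (he.isOpen_range.preimage hγ.continuous).mem_nhds ⟨z, hz⟩
  obtain ⟨ε, hε, hb⟩ := Metric.mem_nhds_iff.1 hnb
  have harc : ∀ s ∈ Icc (-(ε / 2)) (ε / 2), γ s ∈ range e := fun s hs => hb (by
    rw [mem_ball, Real.dist_eq]; exact abs_lt.2 ⟨by linarith [hs.1], by linarith [hs.2]⟩)
  obtain ⟨hJc, hJl⟩ := pre_arc hγ he (by linarith) harc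
  have hFc : IsClosed (e ⁻¹' (γ '' (Iic (-(ε / 2)) ∪ Ici (ε / 2)))) :=
    pre_closed hγ hcl he.continuous hr (isClosed_Iic.union isClosed_Ici)
  obtain ⟨ρ, hρ, hdis⟩ := pre_ball hγ hFc hz (by
    rintro (h | h)
    · have := mem_Iic.1 h; linarith
    · have := mem_Ici.1 h; linarith)
  obtain ⟨c, hc⟩ := harc (-(ε / 2)) ⟨le_rfl, by linarith⟩
  obtain ⟨d, hd⟩ := harc (ε / 2) ⟨by linarith, le_rfl⟩
  have hFJ : e ⁻¹' (γ '' (Iic (-(ε / 2)) ∪ Ici (ε / 2))) ∩ e ⁻¹' (γ '' Icc (-(ε / 2)) (ε / 2))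
      ⊆ {c, d} := by
    rintro w ⟨⟨s, hs1, hs2⟩, s', hs1', hs2'⟩
    have hss' : s = s' := hγ.injective (hs2.trans hs2'.symm)
    subst hss'
    rcases hs1 with h | h
    · left
      have : s = -(ε / 2) := le_antisymm h hs1'.1
      exact he.injective (by rw [hc, ← hs2, this])
    · right
      have : s = ε / 2 := le_antisymm hs1'.2 h
      exact he.injective (by rw [hd, ← hs2, this])
  have hBo : IsOpen (e '' ball z ρ) := he.isOpenMap _ isOpen_ball
  have htB : γ 0 ∈ e '' ball z ρ := ⟨z, mem_ball_self hρ, hz⟩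
  have hq : ∀ x ∈ U \ range γ, ∃ q ∈ ball z ρ, e q ∈ connectedComponentIn (U \ range γ) x := by
    intro x hx
    have := cross_b hS hU hUc hγ hγU hcl hop hx (mem_range_self 0)
    obtain ⟨_, ⟨q, hq, rfl⟩, hqV⟩ := mem_closure_iff.1 this _ hBo htB
    exact ⟨q, hq, hqV⟩
  obtain ⟨q1, hq1, h1⟩ := hq x1 hx1
  obtain ⟨q2, hq2, h2⟩ := hq x2 hx2
  obtain ⟨q3, hq3, h3⟩ := hq x3 hx3
  have hnJ : ∀ q x, e q ∈ connectedComponentIn (U \ range γ) x → ∀ A : Set ℝ,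
      q ∉ e ⁻¹' (γ '' A) := fun q x h A hA =>
    (connectedComponentIn_subset _ _ h).2 (image_subset_range _ _ hA)
  have htr : ∀ q q' x x', e q ∈ connectedComponentIn (U \ range γ) x →
      e q' ∈ connectedComponentIn (U \ range γ) x' → x' ∈ U \ range γ →
      q' ∈ connectedComponentIn (e ⁻¹' (γ '' (Iic (-(ε / 2)) ∪ Ici (ε / 2))) ∪
        e ⁻¹' (γ '' Icc (-(ε / 2)) (ε / 2)))ᶜ q → x' ∈ connectedComponentIn (U \ range γ) x := by
    intro q q' x x' hqx hqx' hx' hmem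
    set C := connectedComponentIn (e ⁻¹' (γ '' (Iic (-(ε / 2)) ∪ Ici (ε / 2))) ∪
        e ⁻¹' (γ '' Icc (-(ε / 2)) (ε / 2)))ᶜ q with hC
    have hqC : q ∈ C := by
      refine mem_connectedComponentIn ?_
      rintro (h | h)
      · exact hnJ q x hqx _ h
      · exact hnJ q x hqx _ h
    have hCp : IsPreconnected (e '' C) :=
      isPreconnected_connectedComponentIn.image e he.continuous.continuousOn
    have hCs : e '' C ⊆ U \ range γ := by
      rintro _ ⟨w, hw, rfl⟩
      refine ⟨hr (mem_range_self _), ?_⟩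
      rintro ⟨s, hsw⟩
      apply connectedComponentIn_subset _ _ hw
      by_cases h1 : s ≤ -(ε / 2)
      · exact Or.inl ⟨s, Or.inl h1, hsw⟩
      by_cases h2 : s ≤ ε / 2
      · exact Or.inr ⟨s, ⟨(not_le.1 h1).le, h2⟩, hsw⟩
      · exact Or.inl ⟨s, Or.inr (not_le.1 h2).le, hsw⟩
    have := hCp.subset_connectedComponentIn (mem_image_of_mem e hqC) hCs (mem_image_of_mem e hmem)
    rw [connectedComponentIn_eq hqx, connectedComponentIn_eq this, ← connectedComponentIn_eq hqx']
    exact mem_connectedComponentIn hx'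
  rcases PL2 hFc hJc hdis hJl c d hFJ hq1 hq2 hq3 (hnJ _ _ h1 _) (hnJ _ _ h2 _) (hnJ _ _ h3 _)
    with h | h | h
  · exact Or.inl (htr _ _ _ _ h1 h2 hx2 h)
  · exact Or.inr (Or.inl (htr _ _ _ _ h1 h3 hx3 h))
  · exact Or.inr (Or.inr (htr _ _ _ _ h2 h3 hx3 h))

end Crosscut


section Shadows

theorem nested_preconn {S : Type*} [TopologicalSpace S] [CompactSpace S] [T2Space S]
    (C : ℕ → Set S) (hanti : Antitone C) (hcl : ∀ n, IsClosed (C n))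
    (hp : ∀ n, IsPreconnected (C n)) : IsPreconnected (⋂ n, C n) := by
  rw [isPreconnected_closed_iff]
  intro t t' ht ht' hsub h1 h2
  by_contra hcon
  have hI : IsClosed (⋂ n, C n) := isClosed_iInter hcl
  have hd : Disjoint ((⋂ n, C n) ∩ t) ((⋂ n, C n) ∩ t') :=
    disjoint_left.2 fun x hx hx' => hcon ⟨x, hx.1, hx.2, hx'.2⟩
  obtain ⟨O1, O2, hO1, hO2, hA, hB, hO⟩ := normal_separation (hI.inter ht) (hI.inter ht') hd
  obtain ⟨n, hn⟩ := exists_subset_nhds_of_compactSpace (V := C)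
    (hanti.directed_ge) hcl (U := O1 ∪ O2) (fun x hx => by
      apply (hO1.union hO2).mem_nhds
      rcases hsub hx with h | h
      · exact Or.inl (hA ⟨hx, h⟩)
      · exact Or.inr (hB ⟨hx, h⟩))
  obtain ⟨x, hx⟩ := h1
  obtain ⟨y, hy⟩ := h2
  obtain ⟨w, -, hw1, hw2⟩ := hp n O1 O2 hO1 hO2 hn ⟨x, mem_iInter.1 hx.1 n, hA hx⟩
    ⟨y, mem_iInter.1 hy.1 n, hB hy⟩
  exact disjoint_left.1 hO hw1 hw2

theorem ends {S : Type*} [TopologicalSpace S] [CompactSpace S] [T2Space S] {γ : ℝ → S}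
    (hγ : IsEmbedding γ) : ∃ L1 L2 : Set S, IsPreconnected L1 ∧ IsPreconnected L2 ∧
      closure (range γ) \ range γ = L1 ∪ L2 := by
  have hpre : ∀ A : Set ℝ, IsPreconnected A → IsPreconnected (closure (γ '' A)) := fun A hA =>
    (hA.image γ hγ.continuous.continuousOn).closure
  have hout : ∀ (A : Set ℝ) (s : ℝ), IsClosed A → s ∉ A → γ s ∉ closure (γ '' A) := by
    intro A s hA hs h
    apply hs
    have := hγ.isInducing.closure_eq_preimage_closure_image A
    rw [hA.closure_eq] at this
    rw [this]
    exact h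
  have a1 : Antitone fun n : ℕ => closure (γ '' Ici (n : ℝ)) := fun m n hmn =>
    closure_mono (image_mono (Ici_subset_Ici.2 (by exact_mod_cast hmn)))
  have a2 : Antitone fun n : ℕ => closure (γ '' Iic (-(n : ℝ))) := fun m n hmn =>
    closure_mono (image_mono (Iic_subset_Iic.2 (by
      have : (m : ℝ) ≤ n := by exact_mod_cast hmn
      linarith)))
  refine ⟨⋂ n : ℕ, closure (γ '' Ici (n : ℝ)), ⋂ n : ℕ, closure (γ '' Iic (-(n : ℝ))),
    nested_preconn _ a1 (fun n => isClosed_closure) (fun n => hpre _ isPreconnected_Ici),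
    nested_preconn _ a2 (fun n => isClosed_closure) (fun n => hpre _ isPreconnected_Iic), ?_⟩
  apply Subset.antisymm
  · rintro x ⟨hx, hxn⟩
    by_contra hcon
    rw [mem_union, not_or, mem_iInter, mem_iInter] at hcon
    push Not at hcon
    obtain ⟨⟨m, hm⟩, n, hn⟩ := hcon
    have hcov : range γ ⊆ γ '' Ici (m : ℝ) ∪ γ '' Iic (-(n : ℝ)) ∪ γ '' Icc (-(n : ℝ)) m := by
      rintro _ ⟨s, rfl⟩
      by_cases h1 : (m : ℝ) ≤ s
      · exact Or.inl (Or.inl ⟨s, h1, rfl⟩)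
      by_cases h2 : s ≤ -(n : ℝ)
      · exact Or.inl (Or.inr ⟨s, h2, rfl⟩)
      · exact Or.inr ⟨s, ⟨(not_le.1 h2).le, (not_le.1 h1).le⟩, rfl⟩
    have hc : IsClosed (γ '' Icc (-(n : ℝ)) m) := (isCompact_Icc.image hγ.continuous).isClosed
    have := closure_mono hcov hx
    rw [closure_union, closure_union, hc.closure_eq] at this
    rcases this with (h | h) | h
    · exact hm h
    · exact hn h
    · exact hxn (image_subset_range _ _ h)
  · rintro x (hx | hx)
    · refine ⟨closure_mono (image_subset_range _ _) (mem_iInter.1 hx 0), ?_⟩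
      rintro ⟨s, rfl⟩
      obtain ⟨n, hn⟩ := exists_nat_gt s
      exact hout _ s isClosed_Ici (fun h => absurd (mem_Ici.1 h) (not_le.2 hn)) (mem_iInter.1 hx n)
    · refine ⟨closure_mono (image_subset_range _ _) (mem_iInter.1 hx 0), ?_⟩
      rintro ⟨s, rfl⟩
      obtain ⟨n, hn⟩ := exists_nat_gt (-s)
      exact hout _ s isClosed_Iic (fun h => absurd (mem_Iic.1 h) (not_le.2 (by linarith)))
        (mem_iInter.1 hx n)

theorem preconn_one_piece {S ι : Type*} [TopologicalSpace S] [Finite ι] [Nonempty ι] {L : Set S}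
    (hL : IsPreconnected L) (P : ι → Set S) (hP : ∀ i, IsClosed (P i))
    (hd : ∀ i j, i ≠ j → Disjoint (P i) (P j)) (hsub : L ⊆ ⋃ i, P i) :
    ∃ i0, ∀ i, (L ∩ P i).Nonempty → i = i0 := by
  classical
  by_cases hex : ∃ i, (L ∩ P i).Nonempty
  · obtain ⟨i0, h0⟩ := hex
    refine ⟨i0, fun i hi => ?_⟩
    by_contra hne
    have hcl : IsClosed (⋃ j : {j // j ≠ i0}, P j) := isClosed_iUnion_of_finite fun j => hP j
    obtain ⟨w, -, hw1, hw2⟩ := isPreconnected_closed_iff.1 hL (P i0) _ (hP i0) hcl (by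
      intro x hx
      obtain ⟨j, hj⟩ := mem_iUnion.1 (hsub hx)
      by_cases hji : j = i0
      · exact Or.inl (hji ▸ hj)
      · exact Or.inr (mem_iUnion.2 ⟨⟨j, hji⟩, hj⟩)) h0 (by
      obtain ⟨x, hx, hx'⟩ := hi
      exact ⟨x, hx, mem_iUnion.2 ⟨⟨i, hne⟩, hx'⟩⟩)
    obtain ⟨⟨j, hj⟩, hwj⟩ := mem_iUnion.1 hw2
    exact disjoint_left.1 (hd j i0 hj) hwj hw1
  · exact ⟨Classical.arbitrary ι, fun i hi => absurd ⟨i, hi⟩ hex⟩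

/-- bounded partitions give few preconnected pieces -/
theorem pieces_of_bound {S : Type*} [TopologicalSpace S] {T : Set S} (hT : IsClosed T) (M : ℕ)
    (hM : ∀ (ι : Type) [Fintype ι] (P : ι → Set S), (∀ i, IsClosed (P i)) → (∀ i, (P i).Nonempty) →
      (∀ i j, i ≠ j → Disjoint (P i) (P j)) → ⋃ i, P i = T → Fintype.card ι ≤ M) :
    ∃ (ι : Type) (_ : Fintype ι) (P : ι → Set S), Fintype.card ι ≤ M ∧ (∀ i, IsPreconnected (P i)) ∧
      ⋃ i, P i = T := by
  classical
  rcases T.eq_empty_or_nonempty with rfl | hTn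
  · exact ⟨Empty, inferInstance, fun _ => ∅, by simp, fun i => i.elim, by simp⟩
  let Pr : ℕ → Prop := fun n => ∃ (ι : Type) (_ : Fintype ι) (P : ι → Set S),
    Fintype.card ι = n ∧ (∀ i, IsClosed (P i)) ∧ (∀ i, (P i).Nonempty) ∧
      (∀ i j, i ≠ j → Disjoint (P i) (P j)) ∧ ⋃ i, P i = T
  have hb : ∀ n, Pr n → n ≤ M := by
    rintro n ⟨ι, _, P, rfl, h1, h2, h3, h4⟩
    exact hM ι P h1 h2 h3 h4
  have h1 : Pr 1 := ⟨Unit, inferInstance, fun _ => T, by simp, fun _ => hT, fun _ => hTn,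
    fun i j h => absurd (Subsingleton.elim i j) h, iUnion_const T⟩
  have hspec : Pr (Nat.findGreatest Pr M) := Nat.findGreatest_spec (hb 1 h1) h1
  have hmax : ¬ Pr (Nat.findGreatest Pr M + 1) := fun h => by
    have := Nat.le_findGreatest (hb _ h) h
    omega
  obtain ⟨ι, _, P, hc, hPc, hPn, hPd, hPT⟩ := hspec
  refine ⟨ι, inferInstance, P, hc ▸ Nat.findGreatest_le M, fun i => ?_, hPT⟩
  rw [isPreconnected_closed_iff]
  intro t t' ht ht' hsub hn hn'
  by_contra hcon
  apply hmax
  have hdis : Disjoint (P i ∩ t) (P i ∩ t') :=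
    disjoint_left.2 fun x hx hx' => hcon ⟨x, hx.1, hx.2, hx'.2⟩
  let P' : Option ι → Set S := fun o => o.elim (P i ∩ t') fun j => if j = i then P i ∩ t else P j
  have e0 : P' none = P i ∩ t' := rfl
  have e1 : P' (some i) = P i ∩ t := by simp [P']
  have e2 : ∀ j, j ≠ i → P' (some j) = P j := fun j hj => by simp [P', hj]
  have hns : ∀ j, Disjoint (P' none) (P' (some j)) := by
    intro j
    by_cases hj : j = i
    · subst hj
      rw [e0, e1]
      exact hdis.symm
    · rw [e0, e2 j hj]
      exact (hPd i j (Ne.symm hj)).mono_left inter_subset_left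
  refine ⟨Option ι, inferInstance, P', by rw [Fintype.card_option, hc], ?_, ?_, ?_, ?_⟩
  · rintro (_ | j)
    · exact (hPc i).inter ht'
    · by_cases hj : j = i
      · subst hj
        rw [e1]
        exact (hPc _).inter ht
      · rw [e2 j hj]
        exact hPc j
  · rintro (_ | j)
    · exact hn'
    · by_cases hj : j = i
      · subst hj
        rw [e1]
        exact hn
      · rw [e2 j hj]
        exact hPn j
  · have hsub' : ∀ j, P' (some j) ⊆ P j := by
      intro j
      by_cases hj : j = i
      · subst hj
        rw [e1]
        exact inter_subset_left
      · rw [e2 j hj]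
    rintro (_ | j) (_ | k) hjk
    · exact absurd rfl hjk
    · exact hns k
    · exact (hns j).symm
    · exact (hPd j k (fun h => hjk (by rw [h]))).mono (hsub' j) (hsub' k)
  · rw [← hPT]
    apply Subset.antisymm
    · refine iUnion_subset ?_
      rintro (_ | j)
      · exact inter_subset_left.trans (subset_iUnion P i)
      · by_cases hj : j = i
        · subst hj
          rw [e1]
          exact inter_subset_left.trans (subset_iUnion P _)
        · rw [e2 j hj]
          exact subset_iUnion P j
    · refine iUnion_subset fun j => ?_
      by_cases hj : j = i
      · subst hj
        intro x hx
        rcases hsub hx with h | h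
        · exact mem_iUnion.2 ⟨some j, by rw [e1]; exact ⟨hx, h⟩⟩
        · exact mem_iUnion.2 ⟨none, hx, h⟩
      · intro x hx
        exact mem_iUnion.2 ⟨some j, by rw [e2 j hj]; exact hx⟩

theorem dom_compl_conn {S : Type*} [TopologicalSpace S] [LocallyConnectedSpace S] [ConnectedSpace S]
    {X U : Set S} (hX : IsClosed X) (hXc : IsConnected X) (hU : IsComplementaryDomain X U) :
    IsPreconnected Uᶜ := by
  obtain ⟨x0, hx0⟩ := hXc.nonempty
  obtain ⟨hUo, -, -, hUX⟩ := dom_facts hX hU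
  have hXU : X ⊆ Uᶜ := fun x hx hxU => disjoint_left.1 hUX hxU hx
  refine isPreconnected_of_forall x0 fun y hy => ?_
  by_cases hyX : y ∈ X
  · exact ⟨X, hXU, hx0, hyX, hXc.isPreconnected⟩
  · have hW : IsComplementaryDomain X (connectedComponentIn Xᶜ y) := ⟨y, hyX, rfl⟩
    have hyW : y ∈ connectedComponentIn Xᶜ y := mem_connectedComponentIn hyX
    obtain ⟨hWo, hWc, hWf, hWX⟩ := dom_facts hX hW
    set W := connectedComponentIn Xᶜ y
    have hdis : Disjoint W U := by
      rw [disjoint_left]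
      intro z hz hz'
      exact hy (dom_eq hW hU hz hz' ▸ hyW)
    have hWU : closure W ⊆ Uᶜ := fun z hz hzU =>
      disjoint_left.1 (hdis.closure_left hUo) hz hzU
    obtain ⟨w, -, hw⟩ := preconn_meets_frontier (isPreconnected_univ (α := S)) (U := W)
      ⟨y, trivial, hyW⟩ ⟨x0, trivial, fun h => disjoint_left.1 hWX h hx0⟩
    exact ⟨closure W ∪ X, union_subset hWU hXU, Or.inr hx0, Or.inl (subset_closure hyW),
      hWc.isPreconnected.closure.union w hw.1 (hWf hw) hXc.isPreconnected⟩

theorem comp_compl_conn {S : Type*} [TopologicalSpace S] [LocallyConnectedSpace S] [CompactSpace S]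
    [T2Space S] (hS : LocallyEuclidean2 S) {U : Set S} (hU : IsOpen U) (hUc : IsPreconnected U)
    (hUn : IsPreconnected Uᶜ) {γ : ℝ → S} (hγ : IsEmbedding γ) (hγU : range γ ⊆ U)
    (hcl : closure (range γ) ∩ U ⊆ range γ) (hop : IsOpen (U \ range γ)) {x : S}
    (hx : x ∈ U \ range γ) : IsPreconnected (connectedComponentIn (U \ range γ) x)ᶜ := by
  set V := connectedComponentIn (U \ range γ) x with hV
  have hVU : V ⊆ U \ range γ := connectedComponentIn_subset _ _
  have hVo : IsOpen V := hop.connectedComponentIn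
  have hKV : closure (range γ) ⊆ Vᶜ := fun z hz hzV =>
    disjoint_left.1 ((disjoint_left.2 fun y hy hyV => (hVU hyV).2 hy :
      Disjoint (range γ) V).closure_left hVo) hz hzV
  have hmeet : ∃ w ∈ closure (range γ), w ∈ Uᶜ := by
    by_contra hcon
    push Not at hcon
    have hcl' : IsClosed (range γ) := by
      apply isClosed_of_closure_subset
      exact fun z hz => hcl ⟨hz, by simpa using hcon z hz⟩
    have hcomp : IsCompact (γ '' univ) := by rw [image_univ]; exact hcl'.isCompact
    exact noncompact_univ ℝ (hγ.isInducing.isCompact_iff.2 hcomp)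
  obtain ⟨w, hw1, hw2⟩ := hmeet
  have hbase : IsPreconnected (closure (range γ) ∪ Uᶜ) :=
    (isPreconnected_range hγ.continuous).closure.union w hw1 hw2 hUn
  refine isPreconnected_of_forall (γ 0) fun y hy => ?_
  by_cases hy1 : y ∈ closure (range γ) ∪ Uᶜ
  · exact ⟨_, union_subset hKV (compl_subset_compl.2 fun z hz => (hVU hz).1),
      Or.inl (subset_closure (mem_range_self 0)), hy1, hbase⟩
  · rw [mem_union, not_or, mem_compl_iff, not_not] at hy1
    have hyU : y ∈ U \ range γ := ⟨hy1.2, fun h => hy1.1 (subset_closure h)⟩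
    refine ⟨closure (connectedComponentIn (U \ range γ) y), ?_,
      cross_b hS hU hUc hγ hγU hcl hop hyU (mem_range_self 0),
      subset_closure (mem_connectedComponentIn hyU), isPreconnected_connectedComponentIn.closure⟩
    have hdis : Disjoint (connectedComponentIn (U \ range γ) y) V := by
      rw [disjoint_left]
      intro z hz hz'
      apply hy
      rw [hV, connectedComponentIn_eq hz', ← connectedComponentIn_eq hz]
      exact mem_connectedComponentIn hyU
    exact fun z hz hzV => disjoint_left.1 (hdis.closure_left hVo) hz hzV

end Shadows


section ClaimTwo

theorem shadow_bound {S : Type*} [MetricSpace S] [CompactSpace S] [LocallyConnectedSpace S]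
    (hS : LocallyEuclidean2 S) : ∃ N : ℕ, ∀ U : Set S, IsOpen U → IsPreconnected U →
      IsPreconnected Uᶜ → ∀ γ : ℝ → S, IsEmbedding γ → range γ ⊆ U →
      closure (range γ) \ range γ ⊆ frontier U → IsOpen (U \ range γ) → ∀ x ∈ U \ range γ,
      ∀ (ι : Type) [Fintype ι] (P : ι → Set S), (∀ i, IsClosed (P i)) → (∀ i, (P i).Nonempty) →
      (∀ i j, i ≠ j → Disjoint (P i) (P j)) →
      ⋃ i, P i = closure (connectedComponentIn (U \ range γ) x) ∩ frontier U →
      Fintype.card ι ≤ N + 2 := by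
  classical
  obtain ⟨N, hN⟩ := rank_lemma hS (isCompact_univ (X := S)) isOpen_univ (subset_univ _)
  refine ⟨N, ?_⟩
  intro U hU hUc hUn γ hγ hγU hfrK hop x hx ι _ P hPc hPn hPd hPT
  by_contra hcard
  push Not at hcard
  have hcl : closure (range γ) ∩ U ⊆ range γ := by
    rintro z ⟨hz, hzU⟩
    by_contra h
    have := hfrK ⟨hz, h⟩
    rw [hU.frontier_eq] at this
    exact this.2 hzU
  have hVn := comp_compl_conn hS hU hUc hUn hγ hγU hcl hop hx
  have hKV := cross_b hS hU hUc hγ hγU hcl hop hx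
  have hfrV := frontier_comp_subset hop x
  set V := connectedComponentIn (U \ range γ) x with hV
  have hVU : V ⊆ U \ range γ := connectedComponentIn_subset _ _
  have hVo : IsOpen V := hop.connectedComponentIn
  have hVp : IsPreconnected (closure V) := isPreconnected_connectedComponentIn.closure
  have hKclV : closure (range γ) ⊆ closure V := closure_minimal hKV isClosed_closure
  have hfU : ∀ z ∈ frontier U, z ∉ U := fun z hz hzU => by
    rw [hU.frontier_eq] at hz
    exact hz.2 hzU
  have hTV : ∀ i, ∀ z ∈ P i, z ∈ closure V ∧ z ∈ frontier U := fun i z hz => by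
    have : z ∈ ⋃ i, P i := mem_iUnion.2 ⟨i, hz⟩
    rw [hPT] at this
    exact this
  have : Nonempty ι := Fintype.card_pos_iff.1 (by omega)
  obtain ⟨L1, L2, hL1, hL2, hL⟩ := ends hγ
  have hLT : closure (range γ) \ range γ ⊆ ⋃ i, P i := by
    rw [hPT]
    exact fun z hz => ⟨hKclV hz.1, hfrK hz⟩
  rw [hL] at hLT
  obtain ⟨j1, hj1⟩ := preconn_one_piece hL1 P hPc hPd (subset_union_left.trans hLT)
  obtain ⟨j2, hj2⟩ := preconn_one_piece hL2 P hPc hPd (subset_union_right.trans hLT)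
  let J : Finset ι := ({j1, j2} : Finset ι)ᶜ
  have hJcard : N < Fintype.card J := by
    rw [Fintype.card_coe, Finset.card_compl]
    have := Finset.card_le_two (a := j1) (b := j2)
    omega
  have hJK : ∀ j ∈ J, Disjoint (closure (range γ)) (P j) := by
    intro j hj
    rw [disjoint_left]
    intro z hz hzP
    have hzL : z ∈ L1 ∪ L2 := by
      rw [← hL]
      exact ⟨hz, fun h => hfU z (hTV j z hzP).2 (hγU h)⟩
    apply Finset.mem_compl.1 hj
    rcases hzL with h | h
    · simp [hj1 j ⟨z, h, hzP⟩]
    · simp [hj2 j ⟨z, h, hzP⟩]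
  have hg : ∀ j : J, ∃ g : S → ℂ, Continuous g ∧ (∀ z ∈ closure (range γ), g z = 0) ∧
      (∀ i, i ≠ (j : ι) → ∀ z ∈ P i, g z = 0) ∧ ∀ z ∈ P j, g z = 1 := by
    intro j
    have hc : IsClosed (closure (range γ) ∪ ⋃ i : {i // i ≠ (j : ι)}, P i) :=
      isClosed_closure.union (isClosed_iUnion_of_finite fun i => hPc i)
    obtain ⟨g, hg0, hg1, -⟩ := exists_continuous_zero_one_of_isClosed hc (hPc j) (by
      refine (hJK j j.2).union_left (disjoint_left.2 fun z hz hzj => ?_)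
      obtain ⟨⟨i, hi⟩, hzi⟩ := mem_iUnion.1 hz
      exact disjoint_left.1 (hPd i j hi) hzi hzj)
    refine ⟨fun z => (g z : ℂ), Complex.continuous_ofReal.comp g.continuous, ?_, ?_, ?_⟩
    · intro z hz
      simp [hg0 (Or.inl hz)]
    · intro i hi z hz
      simp [hg0 (Or.inr (mem_iUnion.2 ⟨⟨i, hi⟩, hz⟩))]
    · intro z hz
      simp [hg1 hz]
  choose g hgc hgK hgO hg1 using hg
  have hgf : ∀ j, ∀ z ∈ frontier V, ex (g j z) = 1 := by
    intro j z hz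
    by_cases hzU : z ∈ U
    · have : z ∈ range γ := by
        by_contra h
        exact hfrV hz ⟨hzU, h⟩
      rw [hgK j z (subset_closure this), ex_zero]
    · have hzT : z ∈ ⋃ i, P i := by
        rw [hPT]
        refine ⟨hz.1, ?_⟩
        rw [hU.frontier_eq]
        exact ⟨closure_mono (fun y hy => (hVU hy).1) hz.1, hzU⟩
      obtain ⟨i, hi⟩ := mem_iUnion.1 hzT
      by_cases hij : i = j
      · subst hij
        rw [hg1 j z hi, ex_one]
      · rw [hgO j i hij z hi, ex_zero]
  have hf : ∀ j, ∃ f : S → ℂ, Continuous f ∧ (∀ z ∈ closure V, f z = ex (g j z)) ∧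
      ∀ z ∉ V, f z = 1 := by
    intro j
    obtain ⟨F, h1, h2, h3⟩ := dom_ext_cont hVo isClosed_univ (f := fun z => ex (g j z))
      (g := fun _ => (1 : ℂ)) (ex_continuous.comp (hgc j)).continuousOn continuousOn_const
      (fun z hz => hgf j z hz.1)
    exact ⟨F, continuousOn_univ.1 h1, fun z hz => h2 z ⟨hz, trivial⟩, fun z hz => h3 z ⟨trivial, hz⟩⟩
  choose f hfc hfV hfn using hf
  have hfne : ∀ j z, f j z ≠ 0 := by
    intro j z
    by_cases hz : z ∈ V
    · rw [hfV j z (subset_closure hz)]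
      exact ex_ne_zero _
    · rw [hfn j z hz]
      exact one_ne_zero
  obtain ⟨e⟩ : Nonempty (J ≃ Fin (Fintype.card J)) := ⟨Fintype.equivFin J⟩
  obtain ⟨n, hn0, hn⟩ := hN (Fin (Fintype.card J)) Unit (by simpa using hJcard)
    (fun k _ => f (e.symm k)) (fun k _ => (hfc _).continuousOn) (fun k _ z _ => hfne _ z)
  obtain ⟨φ, hφc, hφ⟩ := hn ()
  have hφV : ∀ y z, y ∉ V → z ∉ V → φ y = φ z := by
    intro y z hy hz
    refine ex_const hVn (hφc.mono (subset_univ _)) (fun w hw => ?_) hy hz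
    rw [hφ w trivial]
    exact Finset.prod_eq_one fun k _ => by rw [hfn _ w hw, one_zpow]
  have hφ2 : ∀ y ∈ closure V, ∀ z ∈ closure V,
      φ y - ∑ k, (n k : ℂ) * g (e.symm k) y = φ z - ∑ k, (n k : ℂ) * g (e.symm k) z := by
    intro y hy z hz
    refine ex_const (φ := fun w => φ w - ∑ k, (n k : ℂ) * g (e.symm k) w) hVp ?_ ?_ hy hz
    · refine (hφc.mono (subset_univ _)).sub ?_
      exact continuousOn_finsetSum _ fun k _ => continuousOn_const.mul (hgc _).continuousOn
    · intro w hw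
      rw [ex_sub, ex_sum, hφ w trivial]
      have : ∀ k, ex ((n k : ℂ) * g (e.symm k) w) = f (e.symm k) w ^ n k := by
        intro k
        rw [ex_int_mul, hfV _ w hw]
      rw [Finset.prod_congr rfl fun k _ => this k, div_self]
      exact Finset.prod_ne_zero_iff.2 fun k _ => zpow_ne_zero _ (hfne _ w)
  apply hn0
  funext k
  obtain ⟨y, hy⟩ := hPn (e.symm k)
  have hyV : y ∉ V := fun h => hfU y (hTV _ y hy).2 (hVU h).1
  have hpV : γ 0 ∉ V := fun h => (hVU h).2 (mem_range_self 0)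
  have h1 := hφ2 y (hTV _ y hy).1 (γ 0) (hKV (mem_range_self 0))
  rw [hφV y (γ 0) hyV hpV, Finset.sum_eq_single k, hg1 _ y hy] at h1
  · have h2 : ∑ k, (n k : ℂ) * g (e.symm k) (γ 0) = 0 :=
      Finset.sum_eq_zero fun k _ => by
        rw [hgK _ _ (subset_closure (mem_range_self 0)), mul_zero]
    rw [h2, mul_one, sub_zero, sub_eq_self] at h1
    exact_mod_cast h1
  · intro i _ hik
    rw [hgO (e.symm i) (e.symm k) (fun h => hik (e.symm.injective (Subtype.ext h.symm))) y hy,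
      mul_zero]
  · exact fun h => absurd (Finset.mem_univ _) h

theorem cross_open {S : Type*} [TopologicalSpace S] {U K : Set S} (hU : IsOpen U)
    (h : IsGenCrosscut U K) : IsOpen (U \ K) ∧ closure K ∩ U ⊆ K := by
  have hcl : closure K ∩ U ⊆ K := by
    rintro z ⟨hz, hzU⟩
    by_contra hK
    have := h.2.2 ⟨hz, hK⟩
    rw [hU.frontier_eq] at this
    exact this.2 hzU
  refine ⟨?_, hcl⟩
  have : U \ K = U \ closure K := by
    ext z
    constructor
    · exact fun hz => ⟨hz.1, fun hc => hz.2 (hcl ⟨hc, hz.1⟩)⟩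
    · exact fun hz => ⟨hz.1, fun hc => hz.2 (subset_closure hc)⟩
  rw [this]
  exact hU.sdiff isClosed_closure

theorem cross_dense {S : Type*} [TopologicalSpace S] (hS : LocallyEuclidean2 S) {U K : Set S}
    (hU : IsOpen U) (h : IsGenCrosscut U K) : U ⊆ closure (U \ K) := by
  obtain ⟨γ, hγ, rfl⟩ := param h
  intro x hx
  rw [_root_.mem_closure_iff]
  intro o ho hxo
  have hne : ¬ (o ∩ U ⊆ range γ) := by
    intro hsub
    have : x ∈ interior (range γ) := mem_interior.2 ⟨_, hsub, ho.inter hU, hxo, hx⟩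
    rw [embed_empty_interior hS hγ] at this
    exact this
  obtain ⟨y, ⟨hyo, hyB⟩, hyK⟩ := not_subset.1 hne
  exact ⟨y, hyo, hyB, hyK⟩

theorem claim_two {S : Type*} [MetricSpace S] [CompactSpace S] [ConnectedSpace S]
    (hS : LocallyEuclidean2 S) : ∃ r : ℕ, ∀ X U K : Set S, IsContinuum X →
      IsComplementaryDomain X U → IsGenCrosscut U K →
      ∃ (ι : Type) (_ : Fintype ι) (F : ι → Set S), Fintype.card ι ≤ r ∧
        (∀ i, IsPreconnected (F i)) ∧ (∀ i, ∃ T, IsShadowOf U K T ∧ F i ⊆ T) ∧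
        frontier U ⊆ ⋃ i, F i := by
  classical
  have := locConn hS
  obtain ⟨N, hN⟩ := shadow_bound hS
  refine ⟨(N + 2) + (N + 2), fun X U K hX hdU hK => ?_⟩
  obtain ⟨hU, hUc, -, -⟩ := dom_facts hX.1.isClosed hdU
  have hUn := dom_compl_conn hX.1.isClosed hX.2 hdU
  obtain ⟨hop, hcl⟩ := cross_open hU hK
  have hden := cross_dense hS hU hK
  have hfrK := hK.2.2
  have hKU := hK.1
  have hpc : ∀ x ∈ U \ K, ∃ (ι : Type) (_ : Fintype ι) (P : ι → Set S),
      Fintype.card ι ≤ N + 2 ∧ (∀ i, IsPreconnected (P i)) ∧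
      ⋃ i, P i = closure (connectedComponentIn (U \ K) x) ∩ frontier U := by
    intro x hx
    obtain ⟨γ, hγ, rfl⟩ := param hK
    exact pieces_of_bound (isClosed_closure.inter isClosed_frontier) (N + 2)
      (fun ι _ P => hN U hU hUc.isPreconnected hUn γ hγ hKU hfrK hop x hx ι P)
  have hne : (U \ K).Nonempty := by
    obtain ⟨u, hu⟩ := hUc.nonempty
    exact closure_nonempty_iff.1 ⟨u, hden hu⟩
  have htwo : ∃ x1 ∈ U \ K, ∃ x2 ∈ U \ K, ∀ x ∈ U \ K,
      x ∈ connectedComponentIn (U \ K) x1 ∨ x ∈ connectedComponentIn (U \ K) x2 := by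
    obtain ⟨x1, hx1⟩ := hne
    by_cases hall : ∀ x ∈ U \ K, x ∈ connectedComponentIn (U \ K) x1
    · exact ⟨x1, hx1, x1, hx1, fun x hx => Or.inl (hall x hx)⟩
    · push Not at hall
      obtain ⟨x2, hx2, hx12⟩ := hall
      refine ⟨x1, hx1, x2, hx2, fun x hx => ?_⟩
      obtain ⟨γ, hγ, rfl⟩ := param hK
      exact (cross_a hS hU hUc.isPreconnected hγ hKU hcl hop hx1 hx2 hx).resolve_left hx12
  obtain ⟨x1, hx1, x2, hx2, hx12⟩ := htwo
  obtain ⟨ι1, _, P1, hc1, hp1, hu1⟩ := hpc x1 hx1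
  obtain ⟨ι2, _, P2, hc2, hp2, hu2⟩ := hpc x2 hx2
  refine ⟨ι1 ⊕ ι2, inferInstance, Sum.elim P1 P2, ?_, ?_, ?_, ?_⟩
  · rw [Fintype.card_sum]
    omega
  · rintro (i | i)
    · exact hp1 i
    · exact hp2 i
  · rintro (i | i)
    · exact ⟨_, ⟨x1, hx1, rfl⟩, hu1 ▸ subset_iUnion P1 i⟩
    · exact ⟨_, ⟨x2, hx2, rfl⟩, hu2 ▸ subset_iUnion P2 i⟩
  · intro z hz
    have hzc : z ∈ closure (connectedComponentIn (U \ K) x1 ∪ connectedComponentIn (U \ K) x2) := by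
      have h1 : closure U ⊆ closure (U \ K) := closure_minimal hden isClosed_closure
      exact closure_mono hx12 (h1 hz.1)
    rw [closure_union] at hzc
    rcases hzc with h | h
    · have : z ∈ ⋃ i, P1 i := by rw [hu1]; exact ⟨h, hz⟩
      obtain ⟨i, hi⟩ := mem_iUnion.1 this
      exact mem_iUnion.2 ⟨Sum.inl i, hi⟩
    · have : z ∈ ⋃ i, P2 i := by rw [hu2]; exact ⟨h, hz⟩
      obtain ⟨i, hi⟩ := mem_iUnion.1 this
      exact mem_iUnion.2 ⟨Sum.inr i, hi⟩

end ClaimTwo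

/-- If `X` is an indecomposable continuum in a closed surface `S`, then `X` has a
sequence of complementary domains satisfying the double-pass condition. -/
theorem indecomposable_doublePass
    {S : Type*} [MetricSpace S] [CompactSpace S] [ConnectedSpace S] [Nonempty S]
    (hS : LocallyEuclidean2 S)
    (X : Set S) (hX : IsContinuum X) (hind : ¬ IsDecomposable X) :
    ∃ U : ℕ → Set S, (∀ n, IsComplementaryDomain X (U n)) ∧
      DoublePassCondition X U := by
  classical
  have := locConn hS
  have hXcl : IsClosed X := hX.1.isClosed
  by_cases hnt : X.Nontrivial
  · obtain ⟨r, hr⟩ := claim_two hS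
    have hpos : ∀ n : ℕ, (0 : ℝ) < 1 / ((n : ℝ) + 1) := fun n => by positivity
    choose δ hδ hL using fun n : ℕ => lemmaL hX hind hnt (hpos n) r
    choose U hU hUd using fun n : ℕ => claim_one hS hX hind hnt (hδ n)
    refine ⟨U, hU, ?_⟩
    intro K hK
    have key : ∀ n, ∃ T, IsShadowOf (U n) (K n) T ∧
        hausdorffDist T X ≤ 1 / ((n : ℝ) + 1) := by
      intro n
      obtain ⟨ι, hι, F, hcard, hpre, hT, hcov⟩ := hr X (U n) (K n) hX (hU n) (hK n)
      have hfr := (dom_facts hXcl (hU n)).2.2.1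
      have hTX : ∀ T, IsShadowOf (U n) (K n) T → T ⊆ X := by
        rintro T ⟨x, -, rfl⟩
        exact inter_subset_right.trans hfr
      obtain ⟨i, hi⟩ := hL n ι hcard F hpre
        (fun i => by obtain ⟨T, h1, h2⟩ := hT i; exact h2.trans (hTX T h1))
        (fun x hx => by
          obtain ⟨y, hy, hxy⟩ := hUd n x hx
          obtain ⟨i, hi⟩ := mem_iUnion.1 (hcov hy)
          exact ⟨i, y, hi, hxy⟩)
      obtain ⟨T, h1, h2⟩ := hT i
      refine ⟨T, h1, hausdorffDist_le_of_mem_dist (hpos n).le ?_ ?_⟩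
      · intro x hx
        exact ⟨x, hTX T h1 hx, by rw [dist_self]; exact (hpos n).le⟩
      · intro x hx
        obtain ⟨y, hy, hxy⟩ := hi x hx
        exact ⟨y, h2 hy, hxy.le⟩
    choose Sh hSh hd using key
    exact ⟨Sh, hSh, squeeze_zero (fun n => hausdorffDist_nonneg) hd
      tendsto_one_div_add_atTop_nhds_zero_nat⟩
  · have hsub : X.Subsingleton := not_nontrivial_iff.1 hnt
    obtain ⟨p, hp⟩ := hX.2.nonempty
    have hXp : X = {p} := hsub.eq_singleton_of_mem hp
    obtain ⟨q, hq⟩ : ∃ q, q ∉ X := by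
      obtain ⟨e, he, -⟩ := chartC hS p
      by_contra hcon
      push Not at hcon
      exact zero_ne_one (he.injective (hsub (hcon (e 0)) (hcon (e 1))))
    have hU : IsComplementaryDomain X (connectedComponentIn Xᶜ q) := ⟨q, hq, rfl⟩
    obtain ⟨hUo, hUc, hfr, -⟩ := dom_facts hXcl hU
    refine ⟨fun _ => connectedComponentIn Xᶜ q, fun _ => hU, ?_⟩
    intro K hK
    have hne : ∀ n, (connectedComponentIn Xᶜ q \ K n).Nonempty := fun n =>
      closure_nonempty_iff.1 (hUc.nonempty.mono (cross_dense hS hUo (hK n)))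
    choose x hx using hne
    refine ⟨_, fun n => ⟨x n, hx n, rfl⟩, ?_⟩
    refine tendsto_const_nhds.congr fun n => ?_
    symm
    beta_reduce
    have hT : closure (connectedComponentIn (connectedComponentIn Xᶜ q \ K n) (x n)) ∩
        frontier (connectedComponentIn Xᶜ q) ⊆ {p} := inter_subset_right.trans (hfr.trans hXp.le)
    rcases subset_singleton_iff_eq.1 hT with h | h
    · rw [h, hausdorffDist_empty']
    · rw [h, hXp, hausdorffDist_self_zero]
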